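/- arXiv:math/9512224 — 3 statements merged into one kernel-verified Lean document; each statement's English description precedes it below -/
import Mathlib

section
/- Let q be a prime power and F a finite field with q elements. The number of 2n×2n upper-triangular matrices X over F (i.e., matrices with X i j = 0 whenever i > j) satisfying X² = 0 equals Σ_{j ∈ ℤ} [C(2n, n-3j) − C(2n, n-3j-1)] · q^(n²−3j²−j), where C(m,k) denotes the ordinary binomial coefficient with the convention C(m,k) = 0 unless 0 ≤ k ≤ m (so the sum has finitely many nonzero terms, and each nonzero term has nonnegative exponent n²−3j²−j). -/
/-- Ordinary binomial coefficient with an integer lower index, with the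
convention that `C(m, k) = 0` unless `0 ≤ k ≤ m`. -/
def intChoose (m : ℕ) (k : ℤ) : ℤ :=
  if 0 ≤ k then (m.choose k.toNat : ℤ) else 0

namespace SqZero
/-- Gaussian binomials with integer lower index. -/
def gb (p : ℚ) : ℕ → ℤ → ℚ
  | 0, i => if i = 0 then 1 else 0
  | k + 1, i => p ^ i * gb p k i + gb p k (i - 1)

lemma gb_succ (p : ℚ) (k : ℕ) (i : ℤ) :
    gb p (k + 1) i = p ^ i * gb p k i + gb p k (i - 1) := rfl

lemma gb_succ' (p : ℚ) (hp : p ≠ 0) (k : ℕ) : ∀ i : ℤ,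
    gb p (k + 1) i = gb p k i + p ^ ((k : ℤ) + 1 - i) * gb p k (i - 1) := by
  induction k with
  | zero =>
    intro i
    simp only [gb]
    rcases eq_or_ne i 0 with rfl | h0
    · simp
    · rcases eq_or_ne i 1 with rfl | h1
      · simp
      · simp [h0, sub_eq_zero, h1]
  | succ k ih =>
    intro i
    have e1 : p ^ i * p ^ ((k : ℤ) + 1 - i) = p ^ ((k : ℤ) + 1) := by
      rw [← zpow_add₀ hp]; congr 1; ring
    have e2 : p ^ ((k : ℤ) + 1 + 1 - i) * p ^ (i - 1) = p ^ ((k : ℤ) + 1) := by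
      rw [← zpow_add₀ hp]; congr 1; ring
    have e3 : (k : ℤ) + 1 - (i - 1) = (k : ℤ) + 1 + 1 - i := by ring
    have h1 := ih i
    have h2 := ih (i - 1)
    have h3 := gb_succ p k i
    have h4 := gb_succ p k (i - 1)
    rw [gb_succ p (k + 1) i, e3] at *
    push_cast
    calc _ = p ^ i * (gb p k i + p ^ ((k : ℤ) + 1 - i) * gb p k (i - 1)) +
        (gb p k (i - 1) + p ^ ((k : ℤ) + 1 + 1 - i) * gb p k (i - 1 - 1)) := by rw [← h1, ← h2]
      _ = (p ^ i * gb p k i + gb p k (i - 1)) + p ^ ((k : ℤ) + 1 + 1 - i) *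
        (p ^ (i - 1) * gb p k (i - 1) + gb p k (i - 1 - 1)) := by
          linear_combination (gb p k (i - 1)) * (e1 - e2)
      _ = _ := by rw [← h3, ← h4]

lemma gb_three (p : ℚ) (hp : p ≠ 0) (k : ℕ) (i : ℤ) :
    gb p (k + 1) i + gb p (k + 1) (i - 1) =
      gb p (k + 2) i + (1 - p ^ (k + 1)) * gb p k (i - 1) := by
  have h1 := gb_succ p (k + 1) i
  have h2 := gb_succ' p hp k i
  have h3 := gb_succ p k i
  have e1 : p ^ i * p ^ ((k : ℤ) + 1 - i) = p ^ (k + 1) := by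
    rw [← zpow_add₀ hp, ← zpow_natCast]; congr 1; push_cast; ring
  rw [h1]
  linear_combination h3 - p ^ i * h2 + gb p k (i - 1) * (-e1)

lemma gb_symm (p : ℚ) (hp : p ≠ 0) (k : ℕ) : ∀ i : ℤ, gb p k (k - i) = gb p k i := by
  induction k with
  | zero => intro i; simp [gb]
  | succ k ih =>
    intro i
    rw [gb_succ' p hp k i, gb_succ]
    have h1 := ih i
    have h2 := ih (i - 1)
    have e1 : ((k + 1 : ℕ) : ℤ) - i = (k : ℤ) - (i - 1) := by push_cast; ring
    have e2 : (k : ℤ) - (i - 1) - 1 = k - i := by ring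
    have e3 : (k : ℤ) + 1 - i = (k : ℤ) - (i - 1) := by ring
    rw [e1, e2, h1, h2, e3]; ring

lemma gb_supp (p : ℚ) (k : ℕ) : ∀ i : ℤ, gb p k i ≠ 0 → 0 ≤ i ∧ i ≤ k := by
  induction k with
  | zero => intro i; simp [gb]; omega
  | succ k ih =>
    intro i h
    rw [gb_succ] at h
    by_contra hc
    apply h
    have h1 : gb p k i = 0 := by
      by_contra h0; have := ih _ h0; push_cast at hc; omega
    have h2 : gb p k (i - 1) = 0 := by
      by_contra h0; have := ih _ h0; push_cast at hc; omega
    simp [h1, h2]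

/-- finitely supported -/
def FS (f : ℤ → ℚ) : Prop := (Function.support f).Finite

lemma gb_FS (p : ℚ) (k : ℕ) : FS (gb p k) :=
  (Set.finite_Icc (0 : ℤ) k).subset fun i hi => gb_supp p k i hi

lemma FS.fin {f : ℤ → ℚ} (hf : FS f) (w : ℤ → ℚ) (a b : ℤ) (ha : a ≠ 0) :
    (Function.support fun j => w j * f (a * j + b)).Finite := by
  have : (Function.support fun j : ℤ => f (a * j + b)).Finite :=
    Set.Finite.preimage (f := fun j : ℤ => a * j + b) (s := Function.support f)
      (fun x _ y _ h => by simpa [ha] using h) hf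
  refine this.subset fun j hj => ?_
  simp only [Function.mem_support] at hj ⊢
  exact fun h => hj (by rw [h, mul_zero])

lemma FS.shift {f : ℤ → ℚ} (hf : FS f) : FS (fun i => f (i - 1)) := by
  have := hf.fin (fun _ => 1) 1 (-1) one_ne_zero
  simpa [FS, sub_eq_add_neg] using this

lemma FS.add {f g : ℤ → ℚ} (hf : FS f) (hg : FS g) : FS (fun i => f i + g i) :=
  (hf.union hg).subset (Function.support_add f g)

lemma FS.smul {f : ℤ → ℚ} (c : ℚ) (hf : FS f) : FS (fun i => c * f i) :=
  hf.subset fun i hi => fun h => hi (by simp [h])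

noncomputable def sm (w : ℤ → ℚ) (f : ℤ → ℚ) (a b : ℤ) : ℚ := ∑ᶠ j : ℤ, w j * f (a * j + b)

lemma sm_add (w f g a b) (ha : a ≠ 0) (hf : FS f) (hg : FS g) :
    sm w (fun i => f i + g i) a b = sm w f a b + sm w g a b := by
  unfold sm
  rw [← finsum_add_distrib (hf.fin w a b ha) (hg.fin w a b ha)]
  simp only [mul_add]

lemma sm_smul (c w f a b) (ha : a ≠ 0) (hf : FS f) :
    sm w (fun i => c * f i) a b = c * sm w f a b := by
  unfold sm
  rw [← smul_eq_mul, smul_finsum' c (hf.fin w a b ha)]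
  refine finsum_congr fun j => ?_
  simp only [smul_eq_mul]; ring

lemma mul_sm (c w f a b) (ha : a ≠ 0) (hf : FS f) :
    c * sm w f a b = ∑ᶠ j : ℤ, c * (w j * f (a * j + b)) := by
  unfold sm
  rw [← smul_eq_mul, smul_finsum' c (hf.fin w a b ha)]
  rfl

/-- The functional, even case. -/
noncomputable def Phi (p : ℚ) (s : ℤ) (f : ℤ → ℚ) : ℚ :=
  sm (fun j => p ^ (3 * j ^ 2 + j)) f (-3) s - sm (fun j => p ^ (3 * j ^ 2 + j)) f (-3) (s - 1)
noncomputable def Psi (p : ℚ) (s : ℤ) (f : ℤ → ℚ) : ℚ :=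
  sm (fun j => p ^ (3 * j ^ 2 + 2 * j)) f (-3) s -
    sm (fun j => p ^ (3 * j ^ 2 + 2 * j)) f (-3) (s - 1)

lemma Psi_gb (p : ℚ) (hp : p ≠ 0) (l : ℕ) :
    Psi p l (gb p (2 * l + 1)) = p ^ l * Phi p l (gb p (2 * l)) := by
  have hF := gb_FS p (2 * l)
  have A : Psi p l (gb p (2 * l + 1)) =
      ∑ᶠ j : ℤ, (p ^ (3 * j ^ 2 + 2 * j) * p ^ (l - 3 * j) * gb p (2 * l) (-3 * j + l) -
        p ^ (3 * j ^ 2 + 2 * j) * p ^ (l + 3 * j + 2) * gb p (2 * l) (-3 * j + (l - 2))) := by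
    unfold Psi sm
    rw [← finsum_sub_distrib ((gb_FS p _).fin _ _ _ (by norm_num))
      ((gb_FS p _).fin _ _ _ (by norm_num))]
    refine finsum_congr fun j => ?_
    have h1 := gb_succ p (2 * l) (-3 * j + l)
    have h2 := gb_succ' p hp (2 * l) (-3 * j + (l - 1))
    have e1 : (-3 * j + (l : ℤ)) = l - 3 * j := by ring
    have e2 : ((2 * l : ℕ) : ℤ) + 1 - (-3 * j + (l - 1)) = l + 3 * j + 2 := by push_cast; ring
    have e3 : (-3 * j + (l - 1) - 1 : ℤ) = -3 * j + (l - 2) := by ring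
    have e4 : (-3 * j + (l : ℤ) - 1) = -3 * j + (l - 1) := by ring
    rw [h1, h2, e2, e3, e4, e1]; ring
  rw [A, finsum_sub_distrib (hF.fin _ _ _ (by norm_num)) (hF.fin _ _ _ (by norm_num))]
  unfold Phi
  rw [mul_sub, mul_sm _ _ _ _ _ (by norm_num) hF, mul_sm _ _ _ _ _ (by norm_num) hF]
  congr 1
  · rw [← finsum_comp_equiv (Equiv.neg ℤ)]
    refine finsum_congr fun j => ?_
    simp only [Equiv.neg_apply]
    rw [← gb_symm p hp (2 * l), ← zpow_natCast p l, ← mul_assoc, ← zpow_add₀ hp, ← zpow_add₀ hp]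
    congr 2
    · ring
    · push_cast; ring
  · rw [← finsum_comp_equiv (Equiv.subLeft (-1))]
    refine finsum_congr fun j => ?_
    simp only [Equiv.subLeft_apply]
    rw [← gb_symm p hp (2 * l), ← zpow_natCast p l, ← mul_assoc, ← zpow_add₀ hp, ← zpow_add₀ hp]
    congr 2
    · ring
    · push_cast; ring

lemma Phi_gb_succ (p : ℚ) (hp : p ≠ 0) (l : ℕ) :
    Phi p (l + 1) (gb p (2 * l + 2)) = p ^ (l + 1) * Psi p l (gb p (2 * l + 1)) := by
  have hF := gb_FS p (2 * l + 1)
  have A : Phi p (l + 1) (gb p (2 * l + 2)) =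
      ∑ᶠ j : ℤ, (p ^ (3 * j ^ 2 + j) * p ^ (l + 1 - 3 * j) * gb p (2 * l + 1) (-3 * j + (l + 1)) -
        p ^ (3 * j ^ 2 + j) * p ^ (l + 3 * j + 2) * gb p (2 * l + 1) (-3 * j + (l - 1))) := by
    unfold Phi sm
    rw [← finsum_sub_distrib ((gb_FS p _).fin _ _ _ (by norm_num))
      ((gb_FS p _).fin _ _ _ (by norm_num))]
    refine finsum_congr fun j => ?_
    have h1 := gb_succ p (2 * l + 1) (-3 * j + (l + 1))
    have h2 := gb_succ' p hp (2 * l + 1) (-3 * j + l)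
    have e1 : (-3 * j + (l + 1 : ℤ)) = l + 1 - 3 * j := by ring
    have e2 : ((2 * l + 1 : ℕ) : ℤ) + 1 - (-3 * j + l) = l + 3 * j + 2 := by push_cast; ring
    have e3 : (-3 * j + l - 1 : ℤ) = -3 * j + (l - 1) := by ring
    have e4 : (-3 * j + (l + 1 : ℤ) - 1) = -3 * j + l := by ring
    have e5 : (-3 * j + (l + 1 - 1 : ℤ)) = -3 * j + l := by ring
    rw [h1, e5, h2, e2, e3, e4, e1]; ring
  rw [A, finsum_sub_distrib (hF.fin _ _ _ (by norm_num)) (hF.fin _ _ _ (by norm_num))]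
  unfold Psi
  rw [mul_sub, mul_sm _ _ _ _ _ (by norm_num) hF, mul_sm _ _ _ _ _ (by norm_num) hF]
  congr 1
  · rw [← finsum_comp_equiv (Equiv.neg ℤ)]
    refine finsum_congr fun j => ?_
    simp only [Equiv.neg_apply]
    rw [← gb_symm p hp (2 * l + 1), ← zpow_natCast p (l + 1), ← mul_assoc, ← zpow_add₀ hp,
      ← zpow_add₀ hp]
    congr 2
    · push_cast; ring
    · push_cast; ring
  · rw [← finsum_comp_equiv (Equiv.subLeft (-1))]
    refine finsum_congr fun j => ?_
    simp only [Equiv.subLeft_apply]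
    rw [← gb_symm p hp (2 * l + 1), ← zpow_natCast p (l + 1), ← mul_assoc, ← zpow_add₀ hp,
      ← zpow_add₀ hp]
    congr 2
    · push_cast; ring
    · push_cast; ring

lemma Phi_gb (p : ℚ) (hp : p ≠ 0) (l : ℕ) : Phi p l (gb p (2 * l)) = p ^ (l ^ 2) := by
  induction l with
  | zero =>
    unfold Phi sm
    rw [finsum_eq_single _ 0, finsum_eq_zero_of_forall_eq_zero]
    · simp [gb]
    · intro j; simp only [gb]; rw [if_neg (by push_cast; omega), mul_zero]
    · intro j hj; simp only [gb]; rw [if_neg (by push_cast; omega), mul_zero]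
  | succ l ih =>
    have h := Phi_gb_succ p hp l
    rw [Psi_gb p hp, ih] at h
    push_cast
    rw [show 2 * (l + 1) = 2 * l + 2 by ring, h]; ring

/-- coefficients of `x^n H_k` -/
def KK (p : ℚ) : ℕ → ℕ → ℤ → ℚ
  | 0, k, i => gb p k i
  | n + 1, k, i => KK p n k i + KK p n k (i - 1)

lemma KK_FS (p : ℚ) (n k : ℕ) : FS (KK p n k) := by
  induction n with
  | zero => exact gb_FS p k
  | succ n ih => exact ih.add ih.shift

lemma KK_step (p : ℚ) (hp : p ≠ 0) (n k : ℕ) : ∀ i,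
    KK p (n + 1) (k + 1) i = KK p n (k + 2) i + (1 - p ^ (k + 1)) * KK p n k (i - 1) := by
  induction n with
  | zero => intro i; exact gb_three p hp k i
  | succ n ih =>
    intro i
    rw [KK, ih, ih, KK, KK]; ring

lemma KK_step_zero (p : ℚ) (n : ℕ) : ∀ i,
    KK p (n + 1) 0 i = KK p n 1 i := by
  induction n with
  | zero =>
    intro i
    simp only [KK, gb]
    by_cases h : i = 0
    · simp [h]
    · simp [h]
  | succ n ih =>
    intro i
    rw [KK, ih, ih, KK]

lemma intChoose_succ (n : ℕ) (i : ℤ) :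
    intChoose (n + 1) i = intChoose n i + intChoose n (i - 1) := by
  unfold intChoose
  rcases lt_trichotomy i 0 with h | rfl | h
  · rw [if_neg (by omega), if_neg (by omega), if_neg (by omega)]; rfl
  · simp
  · obtain ⟨m, rfl⟩ : ∃ m : ℕ, i = m + 1 := ⟨(i - 1).toNat, by omega⟩
    rw [if_pos (by omega), if_pos (by omega), if_pos (by omega)]
    have : ((m : ℤ) + 1).toNat = m + 1 := by omega
    rw [this, Nat.choose_succ_succ]
    simp [add_comm]

lemma KK_zero (p : ℚ) (n : ℕ) : ∀ i, KK p n 0 i = intChoose n i := by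
  induction n with
  | zero =>
    intro i
    simp only [KK, gb, intChoose]
    rcases lt_trichotomy i 0 with h | rfl | h
    · rw [if_neg (by omega), if_neg (by omega)]; simp
    · simp
    · rw [if_neg (by omega), if_pos (by omega), Nat.choose_eq_zero_of_lt (by omega)]; simp
  | succ n ih => intro i; rw [KK, ih, ih, intChoose_succ]; push_cast; rfl

lemma Phi_shift (p : ℚ) (s : ℤ) (f : ℤ → ℚ) :
    Phi p s (fun i => f (i - 1)) = Phi p (s - 1) f := by
  unfold Phi sm
  simp only [add_sub_assoc]

lemma Phi_KK_step (p : ℚ) (hp : p ≠ 0) (n k : ℕ) (s : ℤ) :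
    Phi p s (KK p (n + 1) (k + 1)) =
      Phi p s (KK p n (k + 2)) + (1 - p ^ (k + 1)) * Phi p (s - 1) (KK p n k) := by
  have e : KK p (n + 1) (k + 1) =
      fun i => KK p n (k + 2) i + (1 - p ^ (k + 1)) * KK p n k (i - 1) :=
    funext (KK_step p hp n k)
  have h1 := KK_FS p n (k + 2)
  have h2 := (KK_FS p n k).shift
  rw [e, ← Phi_shift]
  unfold Phi
  rw [sm_add _ _ _ _ _ (by norm_num) h1 (h2.smul _), sm_add _ _ _ _ _ (by norm_num) h1 (h2.smul _),
    sm_smul _ _ _ _ _ (by norm_num) h2, sm_smul _ _ _ _ _ (by norm_num) h2]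
  ring

theorem main_rec (q : ℚ) (hq : q ≠ 0) (g : ℕ → ℕ → ℚ) (g0 : ∀ k, g 0 k = 1)
    (gz : ∀ n, g (n + 1) 0 = q ^ n * g n 1)
    (gs : ∀ n k, g (n + 1) (k + 1) =
      (1 - q⁻¹ ^ (k + 1)) * g n k + q ^ ((n : ℤ) - (k + 1)) * g n (k + 2)) (n : ℕ) :
    ∀ (k s : ℕ), n + k = 2 * s →
      g n k = q ^ (((s : ℤ) - k) ^ 2) * Phi q⁻¹ s (KK q⁻¹ n k) := by
  have hp : q⁻¹ ≠ 0 := inv_ne_zero hq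
  induction n with
  | zero =>
    intro k s h
    obtain rfl : k = 2 * s := by omega
    have : KK q⁻¹ 0 (2 * s) = gb q⁻¹ (2 * s) := rfl
    rw [g0, this, Phi_gb _ hp, ← zpow_natCast, inv_zpow', ← zpow_add₀ hq]
    symm
    convert zpow_zero q using 2
    push_cast; ring
  | succ n ih =>
    intro k s h
    rcases k with _ | k
    · rw [gz, ih 1 s (by omega), show KK q⁻¹ (n + 1) 0 = KK q⁻¹ n 1 from funext (KK_step_zero _ n),
        ← mul_assoc, ← zpow_natCast, ← zpow_add₀ hq]
      congr 2
      have : (n : ℤ) = 2 * s - 1 := by omega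
      rw [this]; push_cast; ring
    · have hn : (n : ℤ) = 2 * s - k - 2 := by omega
      rw [gs, ih k (s - 1) (by omega), ih (k + 2) s (by omega), Phi_KK_step _ hp]
      have : ((s - 1 : ℕ) : ℤ) = s - 1 := by omega
      rw [this]
      have e1 : ((s : ℤ) - 1 - k) ^ 2 = ((s : ℤ) - (k + 1 : ℕ)) ^ 2 := by push_cast; ring
      have e2 : q ^ ((n : ℤ) - (k + 1)) * q ^ (((s : ℤ) - (k + 2 : ℕ)) ^ 2) =
          q ^ (((s : ℤ) - (k + 1 : ℕ)) ^ 2) := by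
        rw [← zpow_add₀ hq]; congr 1; rw [hn]; push_cast; ring
      rw [e1]
      linear_combination Phi q⁻¹ s (KK q⁻¹ n (k + 2)) * e2

theorem final_form (q n : ℕ) (hq : q ≠ 0) :
    (q : ℚ) ^ (((n : ℤ) - (0 : ℕ)) ^ 2) * Phi (q : ℚ)⁻¹ n (KK (q : ℚ)⁻¹ (2 * n) 0) =
    ((∑ᶠ j : ℤ,
        (intChoose (2 * n) ((n : ℤ) - 3 * j) - intChoose (2 * n) ((n : ℤ) - 3 * j - 1)) *
          (q : ℤ) ^ ((n : ℤ) ^ 2 - 3 * j ^ 2 - j).toNat : ℤ) : ℚ) := by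
  have hq' : (q : ℚ) ≠ 0 := by exact_mod_cast hq
  have hp : (q : ℚ)⁻¹ ≠ 0 := inv_ne_zero hq'
  have hsupp : ∀ i, intChoose (2 * n) i ≠ 0 → 0 ≤ i ∧ i ≤ 2 * n := by
    intro i h
    unfold intChoose at h
    split_ifs at h with h0
    · refine ⟨h0, ?_⟩
      by_contra hc
      exact h (by rw [Nat.choose_eq_zero_of_lt (by omega)]; rfl)
    · exact absurd rfl h
  have hF := KK_FS (q : ℚ)⁻¹ (2 * n) 0
  have hfin : (Function.support fun j : ℤ =>
      (intChoose (2 * n) ((n : ℤ) - 3 * j) - intChoose (2 * n) ((n : ℤ) - 3 * j - 1)) *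
          (q : ℤ) ^ ((n : ℤ) ^ 2 - 3 * j ^ 2 - j).toNat).Finite := by
    refine (Set.finite_Icc (-(n : ℤ) - 1) (n + 1)).subset fun j hj => ?_
    by_contra hc
    apply hj
    have h1 : intChoose (2 * n) ((n : ℤ) - 3 * j) = 0 := by
      by_contra h; have := hsupp _ h; simp only [Set.mem_Icc] at hc; omega
    have h2 : intChoose (2 * n) ((n : ℤ) - 3 * j - 1) = 0 := by
      by_contra h; have := hsupp _ h; simp only [Set.mem_Icc] at hc; omega
    simp [h1, h2]
  have hcast := (Int.castAddHom ℚ).map_finsum hfin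
  simp only [Int.coe_castAddHom] at hcast
  rw [hcast]
  unfold Phi sm
  rw [← finsum_sub_distrib (hF.fin _ _ _ (by norm_num)) (hF.fin _ _ _ (by norm_num)),
    ← smul_eq_mul, smul_finsum']
  · refine finsum_congr fun j => ?_
    simp only [KK_zero, smul_eq_mul]
    rw [show -3 * j + (n : ℤ) = n - 3 * j by ring,
      show -3 * j + ((n : ℤ) - 1) = n - 3 * j - 1 by ring]
    by_cases h : intChoose (2 * n) ((n : ℤ) - 3 * j) = 0 ∧
      intChoose (2 * n) ((n : ℤ) - 3 * j - 1) = 0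
    · simp [h.1, h.2]
    · have hnn : 0 ≤ (n : ℤ) ^ 2 - 3 * j ^ 2 - j := by
        by_cases h1 : intChoose (2 * n) ((n : ℤ) - 3 * j) = 0
        · have := hsupp _ (fun h2 => h ⟨h1, h2⟩)
          have h3 : (3 * j + 1) ^ 2 ≤ (n : ℤ) ^ 2 := by
            apply sq_le_sq' <;> omega
          have h4 : 0 ≤ (3 * j + 1) * (2 * j + 1) := by
            rcases le_or_gt 0 j with hj | hj
            · positivity
            · exact mul_nonneg_of_nonpos_of_nonpos (by omega) (by omega)
          nlinarith
        · have := hsupp _ h1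
          have h3 : (3 * j) ^ 2 ≤ (n : ℤ) ^ 2 := by
            apply sq_le_sq' <;> omega
          have h4 : 0 ≤ j * (6 * j - 1) := by
            rcases le_or_gt j 0 with hj | hj
            · exact mul_nonneg_of_nonpos_of_nonpos (by omega) (by omega)
            · exact mul_nonneg (by omega) (by omega)
          nlinarith
      have e : (q : ℚ) ^ (((n : ℤ) - (0 : ℕ)) ^ 2) * (q : ℚ)⁻¹ ^ (3 * j ^ 2 + j) =
          (q : ℚ) ^ ((n : ℤ) ^ 2 - 3 * j ^ 2 - j).toNat := by
        rw [← zpow_natCast, Int.toNat_of_nonneg hnn, inv_zpow', ← zpow_add₀ hq']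
        congr 1; push_cast; ring
      push_cast at e ⊢
      rw [← e]; ring
  · have := ((hF.fin (fun j => (q : ℚ)⁻¹ ^ (3 * j ^ 2 + j)) (-3) n (by norm_num)).union
      (hF.fin (fun j => (q : ℚ)⁻¹ ^ (3 * j ^ 2 + j)) (-3) (n - 1) (by norm_num)))
    exact this.subset (Function.support_sub _ _)

end SqZero

namespace SqZero
open Matrix

variable {F : Type} [Field F]

def Good {n : ℕ} (X : Matrix (Fin n) (Fin n) F) : Prop :=
  (∀ i j : Fin n, j < i → X i j = 0) ∧ X * X = 0

/-- Add a zero column on the left and the row `(0, w)` on top. -/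
def extend {n : ℕ} (Y : Matrix (Fin n) (Fin n) F) (w : Fin n → F) :
    Matrix (Fin (n + 1)) (Fin (n + 1)) F :=
  Matrix.of (Fin.cons (Fin.cons 0 w) (fun i => Fin.cons 0 (Y i)))

lemma extend_zz {n : ℕ} (Y : Matrix (Fin n) (Fin n) F) (w) : extend Y w 0 0 = 0 := rfl
lemma extend_zs {n : ℕ} (Y : Matrix (Fin n) (Fin n) F) (w j) : extend Y w 0 (Fin.succ j) = w j := rfl
lemma extend_sz {n : ℕ} (Y : Matrix (Fin n) (Fin n) F) (w i) : extend Y w (Fin.succ i) 0 = 0 := rfl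
lemma extend_ss {n : ℕ} (Y : Matrix (Fin n) (Fin n) F) (w i j) :
    extend Y w (Fin.succ i) (Fin.succ j) = Y i j := rfl

lemma good_extend {n : ℕ} (Y : Matrix (Fin n) (Fin n) F) (w : Fin n → F) :
    Good (extend Y w) ↔ Good Y ∧ w ᵥ* Y = 0 := by
  unfold Good
  rw [← Matrix.ext_iff, ← Matrix.ext_iff, funext_iff]
  simp only [Fin.forall_fin_succ, Matrix.mul_apply, Fin.sum_univ_succ, extend_zz, extend_zs,
    extend_sz, extend_ss, Matrix.vecMul, dotProduct]
  simp
  tauto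

lemma exists_extend {n : ℕ} (X : Matrix (Fin (n + 1)) (Fin (n + 1)) F) (h : Good X) :
    extend (X.submatrix Fin.succ Fin.succ) (fun j => X 0 j.succ) = X := by
  have h0 : ∀ i : Fin n, X i.succ 0 = 0 := fun i => h.1 _ _ (Fin.succ_pos i)
  have h1 := congrFun (congrFun h.2 0) 0
  simp [Matrix.mul_apply, Fin.sum_univ_succ, h0] at h1
  ext i j
  refine Fin.cases ?_ (fun i => ?_) i <;> refine Fin.cases ?_ (fun j => ?_) j
  · rw [extend_zz, h1]
  · rw [extend_zs]
  · rw [extend_sz, h0]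
  · rw [extend_ss]; rfl

noncomputable def rk {n : ℕ} (X : Matrix (Fin n) (Fin n) F) : ℕ :=
  Module.finrank F (LinearMap.range X.vecMulLinear)

def cz (F : Type) [Field F] (n : ℕ) : (Fin n → F) →ₗ[F] (Fin (n + 1) → F) where
  toFun w := Fin.cons 0 w
  map_add' x y := by ext i; refine Fin.cases ?_ (fun i => ?_) i <;> simp
  map_smul' x y := by ext i; refine Fin.cases ?_ (fun i => ?_) i <;> simp

lemma rk_extend {n : ℕ} (Y : Matrix (Fin n) (Fin n) F) (w : Fin n → F) :
    rk (extend Y w) = Module.finrank F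
      (LinearMap.range Y.vecMulLinear ⊔ Submodule.span F {w} : Submodule F (Fin n → F)) := by
  have hinj : Function.Injective (cz F n) := fun x y h => by
    funext i
    have := congrFun h i.succ
    simpa [cz] using this
  have key : LinearMap.range (extend Y w).vecMulLinear =
      (LinearMap.range Y.vecMulLinear ⊔ Submodule.span F {w}).map (cz F n) := by
    rw [range_vecMulLinear, range_vecMulLinear, ← Submodule.span_union, Submodule.map_span]
    congr 1
    ext v
    constructor
    · rintro ⟨i, rfl⟩
      refine Fin.cases ?_ (fun i => ?_) i
      · exact ⟨w, Or.inr rfl, rfl⟩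
      · exact ⟨Y i, Or.inl ⟨i, rfl⟩, rfl⟩
    · rintro ⟨_, ⟨i, rfl⟩ | rfl, rfl⟩
      · exact ⟨i.succ, rfl⟩
      · exact ⟨0, rfl⟩
  unfold rk
  rw [key]
  exact (Submodule.equivMapOfInjective (cz F n) hinj _).finrank_eq.symm

variable [Fintype F]
open Classical in
noncomputable def gg (F : Type) [Field F] [Fintype F] (n k : ℕ) : ℚ :=
  ∑ X : {X : Matrix (Fin n) (Fin n) F // Good X}, ((Fintype.card F : ℚ)⁻¹ ^ k) ^ rk X.1

open Classical in
lemma inner_sum {n : ℕ} (Y : Matrix (Fin n) (Fin n) F) (hY : Y * Y = 0) (t : ℚ) :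
    ∑ w : {w : Fin n → F // w ᵥ* Y = 0}, t ^ rk (extend Y w.1) =
      (Fintype.card F : ℚ) ^ rk Y * t ^ rk Y +
      ((Fintype.card F : ℚ) ^ ((n : ℤ) - rk Y) - (Fintype.card F : ℚ) ^ rk Y) * t ^ (rk Y + 1) := by
  set R := LinearMap.range Y.vecMulLinear with hR
  have hle : ∀ w, w ∈ R → w ᵥ* Y = 0 := by
    rintro _ ⟨v, rfl⟩
    simp [Matrix.vecMul_vecMul, hY]
  have hrk : ∀ w : Fin n → F, rk (extend Y w) = if w ∈ R then rk Y else rk Y + 1 := by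
    intro w
    rw [rk_extend]
    split_ifs with h
    · rw [sup_eq_left.2 ((Submodule.span_singleton_le_iff_mem _ _).2 h)]; rfl
    · rw [Submodule.finrank_sup_span_singleton h]; rfl
  have hcardR : (Fintype.card {w // w ∈ R} : ℚ) = (Fintype.card F : ℚ) ^ rk Y := by
    rw [Module.card_eq_pow_finrank (K := F) (V := R)]; push_cast; rfl
  have hcardK : (Fintype.card {w : Fin n → F // w ᵥ* Y = 0} : ℚ) =
      (Fintype.card F : ℚ) ^ ((n : ℤ) - rk Y) := by
    have h1 := LinearMap.finrank_range_add_finrank_ker Y.vecMulLinear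
    rw [Module.finrank_fin_fun] at h1
    have h2 : (n : ℤ) - rk Y = (Module.finrank F (LinearMap.ker Y.vecMulLinear) : ℕ) := by
      unfold rk; omega
    rw [h2, zpow_natCast]
    have h3 := Module.card_eq_pow_finrank (K := F) (V := LinearMap.ker Y.vecMulLinear)
    rw [← Nat.cast_pow, ← h3]
    norm_cast
    exact Fintype.card_congr (Equiv.refl _)
  simp only [hrk]
  have e : ∀ w : {w : Fin n → F // w ᵥ* Y = 0}, t ^ (if w.1 ∈ R then rk Y else rk Y + 1) =
      t ^ (rk Y + 1) + if w.1 ∈ R then t ^ rk Y - t ^ (rk Y + 1) else 0 := by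
    intro w; split_ifs <;> ring
  rw [Finset.sum_congr rfl (fun w _ => e w), Finset.sum_add_distrib, Finset.sum_const,
    ← Finset.sum_filter, Finset.sum_const, Finset.card_univ, nsmul_eq_mul, nsmul_eq_mul, hcardK]
  have hc : (Finset.univ.filter (fun w : {w : Fin n → F // w ᵥ* Y = 0} => w.1 ∈ R)).card =
      Fintype.card {w // w ∈ R} := by
    rw [← Fintype.card_subtype]
    exact Fintype.card_congr
      (Equiv.subtypeSubtypeEquivSubtype (fun {w} h => hle w h))
  rw [hc, hcardR]; ring

open Classical in
lemma gg_rec_aux (n k : ℕ) : gg F (n + 1) k =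
    ∑ Y : {X : Matrix (Fin n) (Fin n) F // Good X},
      ∑ w : {w : Fin n → F // w ᵥ* Y.1 = 0},
        ((Fintype.card F : ℚ)⁻¹ ^ k) ^ rk (extend Y.1 w.1) := by
  unfold gg
  rw [← Fintype.sum_sigma']
  symm
  refine Fintype.sum_bijective
    (fun y : (Y : {X : Matrix (Fin n) (Fin n) F // Good X}) × {w : Fin n → F // w ᵥ* Y.1 = 0} =>
      (⟨extend y.1.1 y.2.1, (good_extend _ _).2 ⟨y.1.2, y.2.2⟩⟩ :
        {X : Matrix (Fin (n + 1)) (Fin (n + 1)) F // Good X})) ⟨?_, ?_⟩ _ _ (fun y => rfl)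
  · rintro ⟨⟨Y, hY⟩, w, hw⟩ ⟨⟨Y', hY'⟩, w', hw'⟩ h
    simp only [Subtype.mk.injEq] at h
    have h1 : Y = Y' := by
      ext i j; exact congrFun (congrFun h i.succ) j.succ
    have h2 : w = w' := by
      ext j; exact congrFun (congrFun h 0) j.succ
    subst h1 h2; rfl
  · rintro ⟨X, hX⟩
    have h := exists_extend X hX
    have h' := (good_extend _ _).1 (h.symm ▸ hX)
    exact ⟨⟨⟨_, h'.1⟩, ⟨_, h'.2⟩⟩, Subtype.ext h⟩

lemma gg_rec (n k : ℕ) (hq : (Fintype.card F : ℚ) ≠ 0) : gg F (n + 1) (k + 1) =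
    (1 - (Fintype.card F : ℚ)⁻¹ ^ (k + 1)) * gg F n k +
      (Fintype.card F : ℚ) ^ ((n : ℤ) - (k + 1)) * gg F n (k + 2) := by
  rw [gg_rec_aux]
  unfold gg
  rw [Finset.mul_sum, Finset.mul_sum, ← Finset.sum_add_distrib]
  refine Finset.sum_congr rfl fun Y _ => ?_
  rw [inner_sum _ Y.2.2]
  set q := (Fintype.card F : ℚ)
  set r := rk Y.1
  rw [zpow_sub₀ hq, zpow_sub₀ hq, zpow_natCast, zpow_natCast]
  have : q ^ ((k : ℤ) + 1) = q ^ (k + 1) := by rw [← zpow_natCast]; push_cast; rfl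
  rw [this]
  simp only [inv_pow]
  field_simp
  ring

lemma gg_rec_zero (n : ℕ) (hq : (Fintype.card F : ℚ) ≠ 0) : gg F (n + 1) 0 =
      (Fintype.card F : ℚ) ^ n * gg F n 1 := by
  rw [gg_rec_aux]
  unfold gg
  rw [Finset.mul_sum]
  refine Finset.sum_congr rfl fun Y _ => ?_
  rw [inner_sum _ Y.2.2]
  set q := (Fintype.card F : ℚ)
  set r := rk Y.1
  rw [zpow_sub₀ hq, zpow_natCast, zpow_natCast]
  simp only [inv_pow]
  field_simp
  try ring

lemma gg_zero (k : ℕ) : gg F 0 k = 1 := by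
  classical
  unfold gg
  have hr : ∀ X : Matrix (Fin 0) (Fin 0) F, rk X = 0 := by
    intro X
    unfold rk
    exact Module.finrank_zero_of_subsingleton
  simp only [hr, pow_zero, Finset.sum_const, Finset.card_univ, nsmul_eq_mul, mul_one]
  have : Fintype.card {X : Matrix (Fin 0) (Fin 0) F // Good X} = 1 := by
    rw [Fintype.card_eq_one_iff]
    refine ⟨⟨0, fun i => i.elim0, by simp⟩, fun y => Subsingleton.elim _ _⟩
  rw [this]; simp

lemma gg_k_zero (n : ℕ) : gg F n 0 =
    (Nat.card {X : Matrix (Fin n) (Fin n) F //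
        (∀ i j : Fin n, j < i → X i j = 0) ∧ X * X = 0} : ℚ) := by
  classical
  unfold gg
  simp only [pow_zero, one_pow, Finset.sum_const, Finset.card_univ, nsmul_eq_mul, mul_one]
  rw [Nat.card_eq_fintype_card]
  norm_cast
  exact Fintype.card_congr (Equiv.refl _)
end SqZero

theorem card_square_zero_upper_triangular_even (q n : ℕ)
    (hq : ∃ p k : ℕ, p.Prime ∧ k ≠ 0 ∧ q = p ^ k)
    (F : Type) [Field F] [Fintype F] (hF : Fintype.card F = q) :
    (Nat.card {X : Matrix (Fin (2 * n)) (Fin (2 * n)) F //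
        (∀ i j : Fin (2 * n), j < i → X i j = 0) ∧ X * X = 0} : ℤ) =
      ∑ᶠ j : ℤ,
        (intChoose (2 * n) ((n : ℤ) - 3 * j) - intChoose (2 * n) ((n : ℤ) - 3 * j - 1)) *
          (q : ℤ) ^ ((n : ℤ) ^ 2 - 3 * j ^ 2 - j).toNat := by
  have hq0 : q ≠ 0 := by rw [← hF]; exact Fintype.card_ne_zero
  have hqQ : (q : ℚ) ≠ 0 := by exact_mod_cast hq0
  have hc : (Fintype.card F : ℚ) = q := by rw [hF]
  have h := SqZero.main_rec (q : ℚ) hqQ (SqZero.gg F) SqZero.gg_zero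
    (fun n => by rw [SqZero.gg_rec_zero n (by rw [hc]; exact hqQ), hc])
    (fun n k => by rw [SqZero.gg_rec n k (by rw [hc]; exact hqQ), hc]) (2 * n) 0 n (by ring)
  rw [SqZero.final_form q n hq0, SqZero.gg_k_zero] at h
  exact_mod_cast h
end

section
/- Let q be a prime power and F a finite field with q elements. The number of (2n+1)×(2n+1) upper-triangular matrices X over F (i.e., matrices with X i j = 0 whenever i > j) satisfying X² = 0 equals Σ_{j ∈ ℤ} [C(2n+1, n-3j) − C(2n+1, n-3j-1)] · q^(n²+n−3j²−2j), where C(m,k) denotes the ordinary binomial coefficient with the convention C(m,k) = 0 unless 0 ≤ k ≤ m (so the sum has finitely many nonzero terms, and each nonzero term has nonnegative exponent n²+n−3j²−2j). -/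
noncomputable def lamC (r : ℤ) : ℝ :=
  if r % 6 = 1 ∨ r % 6 = 2 then 1 else if r % 6 = 4 ∨ r % 6 = 5 then -1 else 0

noncomputable def lam (u : ℝ) (r : ℤ) : ℝ := lamC r * u ^ (1 - r ^ 2)

noncomputable def GG (u : ℝ) : ℕ → ℤ → ℝ
  | 0, r => lam u r
  | 1, r => lam u (r + 1) + lam u (r - 1)
  | k + 2, r => GG u (k + 1) (r + 1) + GG u (k + 1) (r - 1)
      - (1 - u ^ (-12 * ((k : ℤ) + 1))) * GG u k r

lemma lamC_neg (r : ℤ) : lamC (-r) = - lamC r := by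
  unfold lamC
  have h : r % 6 = 0 ∨ r % 6 = 1 ∨ r % 6 = 2 ∨ r % 6 = 3 ∨ r % 6 = 4 ∨ r % 6 = 5 := by omega
  rcases h with h | h | h | h | h | h
  · have : (-r) % 6 = 0 := by omega
    norm_num [h, this]
  · have : (-r) % 6 = 5 := by omega
    norm_num [h, this]
  · have : (-r) % 6 = 4 := by omega
    norm_num [h, this]
  · have : (-r) % 6 = 3 := by omega
    norm_num [h, this]
  · have : (-r) % 6 = 2 := by omega
    norm_num [h, this]
  · have : (-r) % 6 = 1 := by omega
    norm_num [h, this]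

lemma lamC_add_three (r : ℤ) : lamC (r + 3) = - lamC r := by
  unfold lamC
  have h : r % 6 = 0 ∨ r % 6 = 1 ∨ r % 6 = 2 ∨ r % 6 = 3 ∨ r % 6 = 4 ∨ r % 6 = 5 := by omega
  rcases h with h | h | h | h | h | h
  · have : (r + 3) % 6 = 3 := by omega
    norm_num [h, this]
  · have : (r + 3) % 6 = 4 := by omega
    norm_num [h, this]
  · have : (r + 3) % 6 = 5 := by omega
    norm_num [h, this]
  · have : (r + 3) % 6 = 0 := by omega
    norm_num [h, this]
  · have : (r + 3) % 6 = 1 := by omega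
    norm_num [h, this]
  · have : (r + 3) % 6 = 2 := by omega
    norm_num [h, this]

lemma lam_neg (u : ℝ) (r : ℤ) : lam u (-r) = - lam u r := by
  simp [lam, lamC_neg]

lemma GG_neg (u : ℝ) (k : ℕ) : ∀ r : ℤ, GG u k (-r) = - GG u k r := by
  induction k using Nat.twoStepInduction with
  | zero => intro r; simp [GG, lam_neg]
  | one =>
    intro r
    have h1 : -r + 1 = -(r - 1) := by ring
    have h2 : -r - 1 = -(r + 1) := by ring
    simp only [GG, h1, h2, lam_neg]; ring
  | more k ih1 ih2 =>
    intro r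
    have h1 : -r + 1 = -(r - 1) := by ring
    have h2 : -r - 1 = -(r + 1) := by ring
    simp only [GG, h1, h2, ih1, ih2]; ring

lemma lam_step (u : ℝ) (hu : 0 < u) (r : ℤ) :
    lam u (r - 1) = - (u ^ (6 * r + 3) * lam u (r + 2)) := by
  have h : r + 2 = (r - 1) + 3 := by ring
  have e : (1 - (r - 1) ^ 2 : ℤ) = (6 * r + 3) + (1 - (r + 2) ^ 2) := by ring
  unfold lam
  rw [e, zpow_add₀ hu.ne']
  rw [show lamC (r + 2) = - lamC (r - 1) by rw [h, lamC_add_three]]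
  ring

lemma GG_step (u : ℝ) (hu : 0 < u) (k : ℕ) : ∀ r : ℤ,
    GG u (k + 1) r = GG u k (r + 1) - u ^ (-(6 * ((k : ℤ) - r) - 3)) * GG u k (r + 2) := by
  induction k with
  | zero =>
    intro r
    simp only [GG, lam_step u hu r]
    rw [show (-(6 * (((0 : ℕ) : ℤ) - r) - 3)) = 6 * r + 3 by push_cast; ring]
    ring
  | succ k ih =>
    intro r
    have hanti : GG u (k + 1) (r + 2) =
        GG u k (r + 1) - u ^ (-(6 * ((k : ℤ) + r + 2) - 3)) * GG u k r := by
      have := ih (-(r + 2))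
      rw [GG_neg, show -(r + 2) + 1 = -(r + 1) by ring, show -(r + 2) + 2 = -r by ring,
        GG_neg, GG_neg, show (k : ℤ) - -(r + 2) = (k : ℤ) + r + 2 by ring] at this
      linarith
    have h1 := ih (r + 1)
    have h2 := ih (r - 1)
    rw [show r - 1 + 1 = r by ring, show r - 1 + 2 = r + 1 by ring] at h2
    rw [GG, hanti, h2]
    have e : u ^ (-12 * ((k : ℤ) + 1)) =
      u ^ (-(6 * (((k + 1 : ℕ) : ℤ) - r) - 3)) * u ^ (-(6 * ((k : ℤ) + r + 2) - 3)) := by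
      rw [← zpow_add₀ hu.ne']; congr 1; push_cast; ring
    rw [e, show (-(6 * ((k : ℤ) - (r - 1)) - 3)) = (-(6 * (((k + 1 : ℕ) : ℤ) - r) - 3)) by
      push_cast; ring]
    ring

lemma GG_one (u : ℝ) (hu : 0 < u) (k : ℕ) : GG u k 1 = u ^ (-3 * (k : ℤ) ^ 2) := by
  induction k with
  | zero => simp [GG, lam, lamC]
  | succ k ih =>
    have h0 : GG u k 0 = 0 := by
      have := GG_neg u k 0
      simp at this; linarith
    have h := GG_step u hu k (-1)
    rw [GG_neg, show (-1 + 1 : ℤ) = 0 by ring, show (-1 + 2 : ℤ) = 1 by ring, h0, ih,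
      ← zpow_add₀ hu.ne'] at h
    rw [show (-3 * ((k + 1 : ℕ) : ℤ) ^ 2) = -(6 * ((k : ℤ) - -1) - 3) + -3 * (k : ℤ) ^ 2 by
      push_cast; ring]
    linarith

/-- three-term recurrence in the form used for counting -/
lemma GG_three (u : ℝ) (k : ℕ) (r : ℤ) :
    GG u (k + 1) r + (1 - u ^ (-12 * (k : ℤ))) * GG u (k - 1) r
      = GG u k (r + 1) + GG u k (r - 1) := by
  cases k with
  | zero => simp [GG]
  | succ k => simp [GG]
open Matrix Module
def UT (F : Type) [Field F] (n : ℕ) : Type :=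
  {X : Matrix (Fin n) (Fin n) F // (∀ i j : Fin n, j < i → X i j = 0) ∧ X * X = 0}

noncomputable instance (F : Type) [Field F] [Fintype F] (n : ℕ) : Fintype (UT F n) := by
  classical
  unfold UT
  exact Fintype.ofFinite _

def extM {F : Type} [Field F] {n : ℕ} (X : Matrix (Fin n) (Fin n) F) (v : Fin n → F) :
    Matrix (Fin (n + 1)) (Fin (n + 1)) F :=
  Matrix.of (Fin.cons (Fin.cons 0 v) (fun i => Fin.cons 0 (X i)))

def consL (F : Type) [Field F] (n : ℕ) : (Fin n → F) →ₗ[F] (Fin (n + 1) → F) where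
  toFun v := Fin.cons 0 v
  map_add' a b := by ext i; refine Fin.cases ?_ (fun i => ?_) i <;> simp
  map_smul' a b := by ext i; refine Fin.cases ?_ (fun i => ?_) i <;> simp

lemma consL_inj (F : Type) [Field F] (n : ℕ) : Function.Injective (consL F n) := by
  intro a b h
  ext i
  simpa [consL] using congrFun h i.succ

lemma extM_sq {F : Type} [Field F] {n : ℕ} (X : Matrix (Fin n) (Fin n) F) (v : Fin n → F) :
    extM X v * extM X v = extM (X * X) (v ᵥ* X) := by
  ext i j
  refine Fin.cases ?_ (fun i => ?_) i <;> refine Fin.cases ?_ (fun j => ?_) j <;>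
    simp [extM, Matrix.mul_apply, Fin.sum_univ_succ, Matrix.vecMul, dotProduct]

lemma extM_zero {F : Type} [Field F] {n : ℕ} (X : Matrix (Fin n) (Fin n) F) (v : Fin n → F) :
    extM X v = 0 ↔ X = 0 ∧ v = 0 := by
  constructor
  · intro h
    constructor
    · ext i j
      simpa [extM] using congrFun (congrFun h i.succ) j.succ
    · ext j
      simpa [extM] using congrFun (congrFun h 0) j.succ
  · rintro ⟨rfl, rfl⟩
    ext i j
    refine Fin.cases ?_ (fun i => ?_) i <;> refine Fin.cases ?_ (fun j => ?_) j <;>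
      simp [extM]

noncomputable def utEquiv (F : Type) [Field F] (n : ℕ) :
    (Σ X : UT F n, {v : Fin n → F // v ᵥ* X.1 = 0}) ≃ UT F (n + 1) :=
  Equiv.ofBijective
    (fun p => ⟨extM p.1.1 p.2.1, by
      constructor
      · intro i j
        refine Fin.cases ?_ (fun i => ?_) i <;> refine Fin.cases ?_ (fun j => ?_) j
        · simp
        · simp
        · simp [extM]
        · intro h
          simpa [extM] using p.1.2.1 i j (by simpa using h)
      · rw [extM_sq, extM_zero]
        exact ⟨p.1.2.2, p.2.2⟩⟩)
    (by
      constructor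
      · rintro ⟨⟨X, hX⟩, ⟨v, hv⟩⟩ ⟨⟨Y, hY⟩, ⟨w, hw⟩⟩ h
        have h' : extM X v = extM Y w := congrArg Subtype.val h
        have e1 : X = Y := by
          ext i j
          simpa [extM] using congrFun (congrFun h' i.succ) j.succ
        have e2 : v = w := by
          ext j
          simpa [extM] using congrFun (congrFun h' 0) j.succ
        subst e1 e2
        rfl
      · rintro ⟨Y, hY1, hY2⟩
        have h00 : Y 0 0 = 0 := by
          have := congrFun (congrFun hY2 0) 0
          rw [Matrix.mul_apply, Fin.sum_univ_succ] at this
          have h0 : ∀ i : Fin n, Y i.succ 0 = 0 := fun i => hY1 _ _ (Fin.succ_pos i)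
          simpa [h0] using this
        have e : Y = extM (Matrix.of fun i j => Y i.succ j.succ) (fun j => Y 0 j.succ) := by
          ext i j
          refine Fin.cases ?_ (fun i => ?_) i <;> refine Fin.cases ?_ (fun j => ?_) j
          · simpa [extM] using h00
          · simp [extM]
          · simpa [extM] using hY1 _ _ (Fin.succ_pos i)
          · simp [extM]
        have hz := hY2
        rw [e, extM_sq, extM_zero] at hz
        refine ⟨⟨⟨_, ?_, hz.1⟩, ⟨_, hz.2⟩⟩, Subtype.ext e.symm⟩
        intro i j hij
        exact hY1 _ _ (by simpa using hij))

noncomputable def rowSp {F : Type} [Field F] {n : ℕ} (X : Matrix (Fin n) (Fin n) F) :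
    Submodule F (Fin n → F) := LinearMap.range X.vecMulLinear

lemma rowSp_eq {F : Type} [Field F] {n : ℕ} (X : Matrix (Fin n) (Fin n) F) :
    rowSp X = Submodule.span F (Set.range X.row) := by
  unfold rowSp
  exact range_vecMulLinear X

noncomputable def rk {F : Type} [Field F] {n : ℕ} (X : Matrix (Fin n) (Fin n) F) : ℕ :=
  finrank F (rowSp X)

lemma rk_extM {F : Type} [Field F] {n : ℕ} (X : Matrix (Fin n) (Fin n) F) (v : Fin n → F) :
    rk (extM X v) = finrank F (rowSp X ⊔ Submodule.span F {v} : Submodule F (Fin n → F)) := by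
  have h : rowSp (extM X v) = (rowSp X ⊔ Submodule.span F {v}).map (consL F n) := by
    rw [rowSp_eq, rowSp_eq, ← Submodule.span_union, Submodule.map_span]
    congr 1
    ext w
    simp only [Set.mem_range, Set.mem_image, Set.mem_union, Set.mem_singleton_iff]
    constructor
    · rintro ⟨i, rfl⟩
      refine Fin.cases ?_ (fun i => ?_) i
      · exact ⟨v, Or.inr rfl, rfl⟩
      · exact ⟨X i, Or.inl ⟨i, rfl⟩, rfl⟩
    · rintro ⟨x, ⟨i, rfl⟩ | rfl, rfl⟩
      · exact ⟨i.succ, rfl⟩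
      · exact ⟨0, rfl⟩
  unfold rk
  rw [h]
  exact (LinearEquiv.finrank_eq (Submodule.equivMapOfInjective _ (consL_inj F n) _)).symm

lemma rk_extM_mem {F : Type} [Field F] {n : ℕ} (X : Matrix (Fin n) (Fin n) F) (v : Fin n → F)
    (h : v ∈ rowSp X) : rk (extM X v) = rk X := by
  rw [rk_extM, sup_eq_left.mpr]
  · rfl
  · simpa using h

lemma rk_extM_not_mem {F : Type} [Field F] {n : ℕ} (X : Matrix (Fin n) (Fin n) F) (v : Fin n → F)
    (h : v ∉ rowSp X) : rk (extM X v) = rk X + 1 := by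
  rw [rk_extM, Submodule.finrank_sup_span_singleton h]
  rfl

lemma rowSp_le {F : Type} [Field F] {n : ℕ} (X : UT F n) :
    rowSp X.1 ≤ LinearMap.ker X.1.vecMulLinear := by
  rintro _ ⟨w, rfl⟩
  simp [Matrix.vecMul_vecMul, X.2.2]

lemma rk_add {F : Type} [Field F] {n : ℕ} (X : Matrix (Fin n) (Fin n) F) :
    rk X + finrank F (LinearMap.ker X.vecMulLinear) = n := by
  have := LinearMap.finrank_range_add_finrank_ker X.vecMulLinear
  exact this.trans (by simp)

lemma two_rk_le {F : Type} [Field F] {n : ℕ} (X : UT F n) : 2 * rk X.1 ≤ n := by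
  have h1 := rk_add X.1
  have h2 := Submodule.finrank_mono (rowSp_le X)
  have h3 : finrank F (rowSp X.1) = rk X.1 := rfl
  omega

lemma sum_ext {F : Type} [Field F] [Fintype F] {n : ℕ} (X : UT F n)
    [Fintype {v : Fin n → F // v ᵥ* X.1 = 0}] (f : ℕ → ℝ) :
    ∑ v : {v : Fin n → F // v ᵥ* X.1 = 0}, f (rk (extM X.1 v.1)) =
      (Fintype.card F : ℝ) ^ (rk X.1) * f (rk X.1) +
      ((Fintype.card F : ℝ) ^ (n - rk X.1) - (Fintype.card F : ℝ) ^ (rk X.1)) * f (rk X.1 + 1) := by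
  classical
  have hk : (Finset.univ.filter (fun v : Fin n → F => v ᵥ* X.1 = 0)).card
      = Fintype.card F ^ (n - rk X.1) := by
    rw [← Fintype.card_subtype]
    have := Module.card_eq_pow_finrank (K := F) (V := LinearMap.ker X.1.vecMulLinear)
    rw [show n - rk X.1 = finrank F (LinearMap.ker X.1.vecMulLinear) by
      have := rk_add X.1; omega, ← this]
    exact Fintype.card_congr (Equiv.refl _)
  have hr : (Finset.univ.filter (fun v : Fin n → F => v ∈ rowSp X.1)).card
      = Fintype.card F ^ (rk X.1) := by
    rw [← Fintype.card_subtype]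
    have := Module.card_eq_pow_finrank (K := F) (V := rowSp X.1)
    exact this
  have hsub : Finset.univ.filter (fun v : Fin n → F => v ∈ rowSp X.1) ⊆
      Finset.univ.filter (fun v : Fin n → F => v ᵥ* X.1 = 0) := by
    intro v hv
    simp only [Finset.mem_filter, Finset.mem_univ, true_and] at hv ⊢
    exact rowSp_le X hv
  rw [← Finset.sum_subtype (Finset.univ.filter (fun v : Fin n → F => v ᵥ* X.1 = 0))
    (by simp) (fun v => f (rk (extM X.1 v))), ← Finset.sum_sdiff hsub]
  have h1 : ∑ v ∈ Finset.univ.filter (fun v : Fin n → F => v ∈ rowSp X.1), f (rk (extM X.1 v))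
      = (Fintype.card F : ℝ) ^ (rk X.1) * f (rk X.1) := by
    rw [Finset.sum_congr rfl (g := fun _ => f (rk X.1)), Finset.sum_const, hr]
    · simp
    · intro v hv
      rw [rk_extM_mem _ _ (by simpa using hv)]
  have h2 : ∑ v ∈ Finset.univ.filter (fun v : Fin n → F => v ᵥ* X.1 = 0) \
      Finset.univ.filter (fun v : Fin n → F => v ∈ rowSp X.1), f (rk (extM X.1 v))
      = ((Fintype.card F : ℝ) ^ (n - rk X.1) - (Fintype.card F : ℝ) ^ (rk X.1)) * f (rk X.1 + 1) := by
    rw [Finset.sum_congr rfl (g := fun _ => f (rk X.1 + 1)), Finset.sum_const,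
      Finset.card_sdiff_of_subset hsub, hk, hr, nsmul_eq_mul, Nat.cast_sub]
    · simp
    · rw [← hk, ← hr]; exact Finset.card_le_card hsub
    · intro v hv
      rw [rk_extM_not_mem]
      simp only [Finset.mem_sdiff, Finset.mem_filter, Finset.mem_univ, true_and] at hv
      exact hv.2
  rw [h1, h2, add_comm]

noncomputable def ZZ (F : Type) [Field F] [Fintype F] (u : ℝ) (n : ℕ) (s : ℤ) : ℝ :=
  ∑ X : UT F n, u ^ (-12 * ((rk X.1 : ℤ) * ((n : ℤ) - rk X.1))) * GG u (n - 2 * rk X.1) s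

lemma ZZ_zero (F : Type) [Field F] [Fintype F] (u : ℝ) (s : ℤ) : ZZ F u 0 s = lam u s := by
  have hu : ∀ X Y : UT F 0, X = Y := fun X Y => Subtype.ext (Subsingleton.elim _ _)
  let X0 : UT F 0 := ⟨0, by simp, by simp⟩
  have h : ∀ X : UT F 0, rk X.1 = 0 := fun X => by
    have := two_rk_le X
    omega
  have : Unique (UT F 0) := ⟨⟨X0⟩, fun X => hu _ _⟩
  unfold ZZ
  rw [Fintype.sum_unique, h]
  simp [GG]

lemma ZZ_succ (F : Type) [Field F] [Fintype F] (u : ℝ) (hu : 0 < u)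
    (hF : u ^ 12 = (Fintype.card F : ℝ)) (n : ℕ) (s : ℤ) :
    ZZ F u (n + 1) s = ZZ F u n (s + 1) + ZZ F u n (s - 1) := by
  classical
  unfold ZZ
  rw [← (utEquiv F n).sum_comp, Fintype.sum_sigma, ← Finset.sum_add_distrib]
  refine Finset.sum_congr rfl fun X _ => ?_
  have h1 := sum_ext X (fun r => u ^ (-12 * ((r : ℤ) * (((n + 1 : ℕ) : ℤ) - r)))
    * GG u (n + 1 - 2 * r) s)
  refine Eq.trans h1 ?_
  have h2 := two_rk_le X
  generalize rk X.1 = r at h2 ⊢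
  obtain ⟨k, rfl⟩ := Nat.exists_eq_add_of_le h2
  have h3 := GG_three u k s
  rw [show 2 * r + k + 1 - 2 * r = k + 1 by omega, show 2 * r + k + 1 - 2 * (r + 1) = k - 1 by omega,
    show 2 * r + k - 2 * r = k by omega, show 2 * r + k - r = r + k by omega, ← mul_add, ← h3, ← hF]
  have e1 : ((u ^ 12) ^ r : ℝ) = u ^ (12 * (r : ℤ)) := by
    rw [← pow_mul, ← zpow_natCast]; congr 1
  have e2 : ((u ^ 12) ^ (r + k) : ℝ) = u ^ (12 * ((r : ℤ) + k)) := by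
    rw [← pow_mul, ← zpow_natCast]; congr 1
  rw [e1, e2]
  have f1 : u ^ (12 * (r : ℤ)) * u ^ (-12 * ((r : ℤ) * (((2 * r + k + 1 : ℕ) : ℤ) - r)))
      = u ^ (-12 * ((r : ℤ) * (((2 * r + k : ℕ) : ℤ) - r))) := by
    rw [← zpow_add₀ hu.ne']; congr 1; push_cast; ring
  have f2 : u ^ (12 * ((r : ℤ) + k)) *
      u ^ (-12 * (((r + 1 : ℕ) : ℤ) * (((2 * r + k + 1 : ℕ) : ℤ) - ((r + 1 : ℕ) : ℤ))))
      = u ^ (-12 * ((r : ℤ) * (((2 * r + k : ℕ) : ℤ) - r))) := by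
    rw [← zpow_add₀ hu.ne']; congr 1; push_cast; ring
  have f3 : u ^ (12 * (r : ℤ)) *
      u ^ (-12 * (((r + 1 : ℕ) : ℤ) * (((2 * r + k + 1 : ℕ) : ℤ) - ((r + 1 : ℕ) : ℤ))))
      = u ^ (-12 * ((r : ℤ) * (((2 * r + k : ℕ) : ℤ) - r))) * u ^ (-12 * (k : ℤ)) := by
    rw [← zpow_add₀ hu.ne', ← zpow_add₀ hu.ne']; congr 1; push_cast; ring
  linear_combination GG u (k + 1) s * f1 + GG u (k - 1) s * f2 - GG u (k - 1) s * f3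

lemma ZZ_eq (F : Type) [Field F] [Fintype F] (u : ℝ) (hu : 0 < u)
    (hF : u ^ 12 = (Fintype.card F : ℝ)) (n : ℕ) : ∀ s : ℤ,
    ZZ F u n s = ∑ i ∈ Finset.range (n + 1), (n.choose i : ℝ) * lam u ((n : ℤ) - 2 * i + s) := by
  induction n with
  | zero => intro s; simp [ZZ_zero]
  | succ n ih =>
    intro s
    rw [ZZ_succ F u hu hF, ih, ih,
      Finset.sum_choose_succ_mul (fun i _ => lam u (((n + 1 : ℕ) : ℤ) - 2 * i + s))]
    congr 1
    · refine Finset.sum_congr rfl fun i _ => ?_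
      congr 2; push_cast; ring
    · refine Finset.sum_congr rfl fun i _ => ?_
      congr 2; push_cast; ring

lemma card_UT (F : Type) [Field F] [Fintype F] (u : ℝ) (hu : 0 < u)
    (hF : u ^ 12 = (Fintype.card F : ℝ)) (n : ℕ) :
    (Nat.card (UT F n) : ℝ) = u ^ (3 * (n : ℤ) ^ 2) * ∑ i ∈ Finset.range (n + 1),
      (n.choose i : ℝ) * lam u ((n : ℤ) - 2 * i + 1) := by
  rw [← ZZ_eq F u hu hF, ZZ, Finset.mul_sum, Finset.sum_congr rfl (g := fun _ => (1 : ℝ))]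
  · simp
  · intro X _
    rw [GG_one u hu, ← zpow_add₀ hu.ne', ← zpow_add₀ hu.ne', Nat.cast_sub (two_rk_le X)]
    convert zpow_zero u using 2
    push_cast
    ring

noncomputable def TT (u : ℝ) (n : ℕ) (d : ℤ) : ℝ :=
  (intChoose (2 * n + 1) ((n : ℤ) - d) : ℝ) *
    (lamC (2 * d + 2) * u ^ (12 * ((n : ℤ) ^ 2 + n) + 4 - 4 * (d + 1) ^ 2))

lemma intChoose_eq_zero (m : ℕ) (k : ℤ) (h : k < 0 ∨ (m : ℤ) < k) : intChoose m k = 0 := by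
  unfold intChoose
  split_ifs with h0
  · rw [Nat.choose_eq_zero_of_lt (by omega)]; rfl
  · rfl

lemma intChoose_natCast (m k : ℕ) : intChoose m (k : ℤ) = (m.choose k : ℤ) := by
  simp [intChoose]

lemma intChoose_symm (m : ℕ) (k : ℤ) : intChoose m ((m : ℤ) - k) = intChoose m k := by
  by_cases h : k < 0 ∨ (m : ℤ) < k
  · rw [intChoose_eq_zero m k h, intChoose_eq_zero m _ (by omega)]
  · push Not at h
    obtain ⟨a, rfl⟩ := Int.eq_ofNat_of_zero_le h.1
    have ha : a ≤ m := by omega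
    rw [← Nat.cast_sub ha, intChoose_natCast, intChoose_natCast, Nat.choose_symm ha]

lemma TT_support (u : ℝ) (n : ℕ) (d : ℤ) (h : d < -(n : ℤ) - 1 ∨ (n : ℤ) < d) : TT u n d = 0 := by
  unfold TT
  rw [intChoose_eq_zero _ _ (by push_cast; omega)]
  simp

lemma fin_supp (u : ℝ) (n : ℕ) (a : ℤ → ℤ) (ha : Function.Injective a) :
    Function.HasFiniteSupport (fun j => TT u n (a j)) := by
  have : (Function.support (fun j => TT u n (a j))) ⊆ a ⁻¹' (Set.Icc (-(n : ℤ) - 1) n) := by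
    intro j hj
    by_contra hc
    apply hj
    apply TT_support
    simp only [Set.mem_preimage, Set.mem_Icc] at hc
    omega
  exact ((Set.finite_Icc _ _).preimage ha.injOn).subset this

lemma card_TT (F : Type) [Field F] [Fintype F] (u : ℝ) (hu : 0 < u)
    (hF : u ^ 12 = (Fintype.card F : ℝ)) (n : ℕ) :
    (Nat.card (UT F (2 * n + 1)) : ℝ) = ∑ᶠ d : ℤ, TT u n d := by
  rw [card_UT F u hu hF, ← finsum_comp_equiv (Equiv.subLeft (n : ℤ)),
    finsum_eq_finsetSum_of_support_subset (s := (Finset.range (2 * n + 2)).map Nat.castEmbedding),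
    Finset.sum_map, Finset.mul_sum]
  · refine Finset.sum_congr rfl fun i _ => ?_
    simp only [Equiv.subLeft_apply, Nat.castEmbedding_apply, TT, lam]
    rw [show (n : ℤ) - ((n : ℤ) - i) = (i : ℤ) by ring, intChoose_natCast,
      show (((2 * n + 1 : ℕ) : ℤ) - 2 * (i : ℤ) + 1) = 2 * ((n : ℤ) - i) + 2 by push_cast; ring,
      show (12 * ((n : ℤ) ^ 2 + n) + 4 - 4 * ((n : ℤ) - i + 1) ^ 2)
        = 3 * ((2 * n + 1 : ℕ) : ℤ) ^ 2 + (1 - (2 * ((n : ℤ) - i) + 2) ^ 2) by push_cast; ring,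
      zpow_add₀ hu.ne']
    push_cast
    ring
  · intro i hi
    by_contra hc
    apply hi
    apply TT_support
    simp only [Equiv.subLeft_apply]
    by_contra h2
    apply hc
    simp only [Finset.coe_map, Set.mem_image, Finset.mem_coe, Finset.mem_range]
    exact ⟨i.toNat, by omega, by simp; omega⟩

lemma TT_split (u : ℝ) (n : ℕ) :
    ∑ᶠ d : ℤ, TT u n d = ∑ᶠ j : ℤ, (TT u n (3 * j) + TT u n (3 * (-1 - j) + 1)) := by
  have h2 : ∀ j : ℤ, TT u n (3 * j + 2) = 0 := by
    intro j
    have e : lamC (2 * (3 * j + 2) + 2) = 0 := by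
      have : (2 * (3 * j + 2) + 2) % 6 = 0 := by omega
      simp [lamC, this]
    simp [TT, e]
  rw [← finsum_comp_equiv (Int.divModEquiv 3).symm, finsum_curry]
  · have e1 : ∀ a : ℤ, ∑ᶠ b : Fin 3, TT u n ((Int.divModEquiv 3).symm (a, b))
        = TT u n (3 * a) + TT u n (3 * a + 1) := by
      intro a
      rw [finsum_eq_sum_of_fintype, Fin.sum_univ_three]
      simp only [Int.divModEquiv_symm_apply]
      have := h2 a
      rw [mul_comm 3 a] at this ⊢
      simp [this]
    simp_rw [e1]
    rw [finsum_add_distrib (fin_supp u n _ (fun a b h => by simpa using h))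
      (fin_supp u n _ (fun a b h => by simpa using h)),
      finsum_add_distrib (fin_supp u n _ (fun a b h => by simpa using h))
      (fin_supp u n _ (fun a b h => by simpa using h)),
      ← finsum_comp_equiv (Equiv.subLeft (-1 : ℤ)) (f := fun j => TT u n (3 * j + 1))]
    rfl
  · have := fin_supp u n id Function.injective_id
    exact Set.Finite.preimage ((Int.divModEquiv 3).symm.injective.injOn) this

lemma TT_term (u : ℝ) (hu : 0 < u) (q n : ℕ) (hq : u ^ 12 = (q : ℝ)) (j : ℤ) :
    TT u n (3 * j) + TT u n (3 * (-1 - j) + 1) =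
      (((intChoose (2 * n + 1) ((n : ℤ) - 3 * j) - intChoose (2 * n + 1) ((n : ℤ) - 3 * j - 1)) *
          (q : ℤ) ^ ((n : ℤ) ^ 2 + n - 3 * j ^ 2 - 2 * j).toNat : ℤ) : ℝ) := by
  have c1 : lamC (2 * (3 * j) + 2) = 1 := by
    have : (2 * (3 * j) + 2) % 6 = 2 := by omega
    simp [lamC, this]
  have c2 : lamC (2 * (3 * (-1 - j) + 1) + 2) = -1 := by
    have : (2 * (3 * (-1 - j) + 1) + 2) % 6 = 4 := by omega
    simp [lamC, this]
  have s2 : intChoose (2 * n + 1) ((n : ℤ) - (3 * (-1 - j) + 1)) =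
      intChoose (2 * n + 1) ((n : ℤ) - 3 * j - 1) := by
    rw [← intChoose_symm]; congr 1; push_cast; ring
  unfold TT
  rw [c1, c2, s2,
    show (12 * ((n : ℤ) ^ 2 + n) + 4 - 4 * (3 * (-1 - j) + 1 + 1) ^ 2)
      = 12 * ((n : ℤ) ^ 2 + n - 3 * j ^ 2 - 2 * j) by ring,
    show (12 * ((n : ℤ) ^ 2 + n) + 4 - 4 * (3 * j + 1) ^ 2)
      = 12 * ((n : ℤ) ^ 2 + n - 3 * j ^ 2 - 2 * j) by ring]
  by_cases hj : (n : ℤ) - 3 * j < 0 ∨ 2 * (n : ℤ) + 1 < (n : ℤ) - 3 * j - 1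
  · rw [intChoose_eq_zero _ ((n : ℤ) - 3 * j) (by push_cast; omega),
      intChoose_eq_zero _ ((n : ℤ) - 3 * j - 1) (by push_cast; omega)]
    simp
  · push Not at hj
    have hnn : 0 ≤ (n : ℤ) ^ 2 + n - 3 * j ^ 2 - 2 * j := by
      rcases le_or_gt 0 j with h | h
      · nlinarith
      · have : (n : ℤ) ≥ -3 * j - 2 := by linarith
        have : (n : ℤ) ≥ -j := by omega
        nlinarith
    have e : u ^ (12 * ((n : ℤ) ^ 2 + n - 3 * j ^ 2 - 2 * j)) =
        (q : ℝ) ^ ((n : ℤ) ^ 2 + n - 3 * j ^ 2 - 2 * j).toNat := by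
      rw [← hq, ← pow_mul, ← zpow_natCast]
      congr 1
      push_cast
      rw [Int.toNat_of_nonneg hnn]
    rw [e]
    push_cast
    ring

theorem card_square_zero_upper_triangular_odd (q n : ℕ)
    (hq : ∃ p k : ℕ, p.Prime ∧ k ≠ 0 ∧ q = p ^ k)
    (F : Type) [Field F] [Fintype F] (hF : Fintype.card F = q) :
    (Nat.card {X : Matrix (Fin (2 * n + 1)) (Fin (2 * n + 1)) F //
        (∀ i j : Fin (2 * n + 1), j < i → X i j = 0) ∧ X * X = 0} : ℤ) =
      ∑ᶠ j : ℤ,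
        (intChoose (2 * n + 1) ((n : ℤ) - 3 * j) - intChoose (2 * n + 1) ((n : ℤ) - 3 * j - 1)) *
          (q : ℤ) ^ ((n : ℤ) ^ 2 + n - 3 * j ^ 2 - 2 * j).toNat := by
  have hq0 : (0 : ℝ) < q := by
    rw [← hF]; exact_mod_cast Fintype.card_pos
  obtain ⟨u, hu, h12⟩ : ∃ u : ℝ, 0 < u ∧ u ^ 12 = (q : ℝ) :=
    ⟨(q : ℝ) ^ (((12 : ℕ) : ℝ)⁻¹), Real.rpow_pos_of_pos hq0 _,
      Real.rpow_inv_natCast_pow hq0.le (by norm_num)⟩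
  have h := card_TT F u hu (by rw [h12, hF]) n
  rw [TT_split] at h
  simp_rw [TT_term u hu q n h12] at h
  have hs : Function.HasFiniteSupport (fun j : ℤ =>
      (intChoose (2 * n + 1) ((n : ℤ) - 3 * j) - intChoose (2 * n + 1) ((n : ℤ) - 3 * j - 1)) *
          (q : ℤ) ^ ((n : ℤ) ^ 2 + n - 3 * j ^ 2 - 2 * j).toNat) := by
    refine (Set.finite_Icc (-(n : ℤ) - 1) n).subset ?_
    intro j hj
    by_contra hc
    apply hj
    simp only [Set.mem_Icc] at hc
    simp only
    rw [intChoose_eq_zero _ ((n : ℤ) - 3 * j) (by push_cast; omega),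
      intChoose_eq_zero _ ((n : ℤ) - 3 * j - 1) (by push_cast; omega)]
    simp
  have hm := AddMonoidHom.map_finsum (Int.castAddHom ℝ) hs
  simp only [Int.coe_castAddHom] at hm
  rw [← hm] at h
  exact_mod_cast h
end

section
/- Let A : ℕ → ℕ → ℤ[q] be the family of polynomials determined by A n 0 = 1 for all n ≥ 1, A 0 r = 0 for all r ≥ 1, and the recurrence A (n+1) (r+1) = q^(r+1) · A n (r+1) + (q^(n−r) − q^r) · A n r for all n, r ≥ 0. Then for every n ≥ 0, the following identity holds in ℤ[q]: Σ_{r=0}^{n} A (2n+1) r = Σ_{j ∈ ℤ} [C(2n+1, n−3j) − C(2n+1, n−3j−1)] · q^(n²+n−3j²−2j), where C(m,k) denotes the ordinary binomial coefficient with C(m,k) = 0 unless 0 ≤ k ≤ m (so the right-hand sum has finitely many nonzero terms, each with nonnegative exponent n²+n−3j²−2j). -/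
open Polynomial

/-- The q-Fibonacci polynomials `∑ (-1)^j y^j q^(j choose 2) [m-j choose j]`. -/
def qFib {K : Type*} [Field K] (q : K) : ℕ → K → K
  | 0, _ => 1
  | 1, _ => 1
  | (m + 2), y => qFib q (m + 1) (q * y) - y * qFib q m (q * y)

theorem qFib_rec2 {K : Type*} [Field K] (q : K) (hq : q ≠ 0) (m : ℕ) :
    ∀ y : K, qFib q (m + 2) (q * y) = qFib q (m + 1) (q * y) - q * y * q ^ m * qFib q m y := by
  induction m using Nat.twoStepInduction with
  | zero => intro y; simp [qFib]
  | one => intro y; simp [qFib]; ring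
  | more m ih1 ih2 =>
    intro y
    have e1 : qFib q (m + 2 + 2) (q * y) =
      qFib q (m + 3) (q * (q * y)) - q * y * qFib q (m + 2) (q * (q * y)) := rfl
    have e2 : qFib q (m + 2 + 1) (q * y) =
      qFib q (m + 2) (q * (q * y)) - q * y * qFib q (m + 1) (q * (q * y)) := rfl
    have e3 : qFib q (m + 2) y = qFib q (m + 1) (q * y) - y * qFib q m (q * y) := rfl
    have h1 := ih1 (q * y)
    have h2 := ih2 (q * y)
    rw [show m + 1 + 2 = m + 3 from rfl, show m + 1 + 1 = m + 2 from rfl] at h2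
    rw [e1, e2, e3, h2]
    rw [h1]
    ring

theorem qFib_rec3 {K : Type*} [Field K] (q : K) (hq : q ≠ 0) (m : ℕ) (y : K) :
    qFib q (m + 3) y = (1 - y) * qFib q (m + 1) (q * y) - y * q ^ (m + 1) * qFib q m y := by
  have e1 : qFib q (m + 3) y = qFib q (m + 2) (q * y) - y * qFib q (m + 1) (q * y) := rfl
  rw [e1, qFib_rec2 q hq m y]
  ring

theorem qFib_D {K : Type*} [Field K] (q : K) (hq : q ≠ 0) (m : ℕ) (y : K) :
    y * q ^ (m + 1) * qFib q (m + 1) (y / q) + (1 - y) * qFib q (m + 1) (q * y) =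
      qFib q (m + 2) y + y * q ^ (m + 1) * qFib q m y := by
  have h := qFib_rec2 q hq (m + 1) (y / q)
  rw [mul_div_cancel₀ _ hq] at h
  have h3 := qFib_rec3 q hq m y
  rw [show m + 1 + 2 = m + 3 from rfl, show m + 1 + 1 = m + 2 from rfl, h3] at h
  linear_combination h

/-- The weight functions. -/
def wt {K : Type*} [Field K] (s : K) (n k : ℤ) (m : ℕ) : K :=
  s ^ (k ^ 2 - n ^ 2 - (k - m) ^ 2) * qFib (s ^ 4) m (s ^ (-4 * k))

theorem wt_step_aux {K : Type*} [Field K] (s : K) (hs : s ≠ 0) (n k r : ℤ) (hk : k = n - 2 * r)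
    (m : ℕ) :
    s ^ (4 * r) * wt s (n + 1) (k + 1) m +
      (s ^ (4 * (n - r)) - s ^ (4 * r)) * wt s (n + 1) (k - 1) m =
    s ^ (k ^ 2 - n ^ 2 - (k - m - 1) ^ 2) *
      (s ^ (-4 * k) * (s ^ 4) ^ m * qFib (s ^ 4) m (s ^ (-4 * k) / s ^ 4) +
        (1 - s ^ (-4 * k)) * qFib (s ^ 4) m (s ^ 4 * s ^ (-4 * k))) := by
  have hy1 : s ^ (-4 * (k + 1)) = s ^ (-4 * k) / s ^ 4 := by
    rw [← zpow_natCast s 4, ← zpow_sub₀ hs]; congr 1; push_cast; ring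
  have hy2 : s ^ (-4 * (k - 1)) = s ^ 4 * s ^ (-4 * k) := by
    rw [← zpow_natCast s 4, ← zpow_add₀ hs]; congr 1; push_cast; ring
  have hm : (s ^ 4) ^ m = s ^ (4 * (m : ℤ)) := by
    rw [zpow_mul]; norm_cast
  unfold wt
  rw [hy1, hy2, hm]
  generalize qFib (s ^ 4) m (s ^ (-4 * k) / s ^ 4) = P1
  generalize qFib (s ^ 4) m (s ^ 4 * s ^ (-4 * k)) = P2
  have a1 : s ^ (4 * r) * s ^ ((k + 1) ^ 2 - (n + 1) ^ 2 - (k + 1 - m) ^ 2) =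
      s ^ (k ^ 2 - n ^ 2 - (k - m - 1) ^ 2) * (s ^ (-4 * k) * s ^ (4 * (m : ℤ))) := by
    rw [← zpow_add₀ hs, ← zpow_add₀ hs, ← zpow_add₀ hs]; congr 1; subst hk; ring
  have a2 : s ^ (4 * (n - r)) * s ^ ((k - 1) ^ 2 - (n + 1) ^ 2 - (k - 1 - m) ^ 2) =
      s ^ (k ^ 2 - n ^ 2 - (k - m - 1) ^ 2) := by
    rw [← zpow_add₀ hs]; congr 1; subst hk; ring
  have a3 : s ^ (4 * r) * s ^ ((k - 1) ^ 2 - (n + 1) ^ 2 - (k - 1 - m) ^ 2) =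
      s ^ (k ^ 2 - n ^ 2 - (k - m - 1) ^ 2) * s ^ (-4 * k) := by
    rw [← zpow_add₀ hs, ← zpow_add₀ hs]; congr 1; subst hk; ring
  linear_combination P1 * a1 + P2 * a2 - P2 * a3

theorem wt_step_zero {K : Type*} [Field K] (s : K) (hs : s ≠ 0) (n k r : ℤ)
    (hk : k = n - 2 * r) :
    s ^ (4 * r) * wt s (n + 1) (k + 1) 0 +
      (s ^ (4 * (n - r)) - s ^ (4 * r)) * wt s (n + 1) (k - 1) 0 = wt s n k 1 := by
  rw [wt_step_aux s hs n k r hk 0]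
  simp [wt, qFib]

theorem wt_step_succ {K : Type*} [Field K] (s : K) (hs : s ≠ 0) (n k r : ℤ)
    (hk : k = n - 2 * r) (m : ℕ) :
    s ^ (4 * r) * wt s (n + 1) (k + 1) (m + 1) +
      (s ^ (4 * (n - r)) - s ^ (4 * r)) * wt s (n + 1) (k - 1) (m + 1) =
      wt s n k (m + 2) + wt s n k m := by
  rw [wt_step_aux s hs n k r hk (m + 1), qFib_D _ (pow_ne_zero 4 hs)]
  unfold wt
  have hm : (s ^ 4) ^ (m + 1) = s ^ (4 * ((m : ℤ) + 1)) := by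
    rw [zpow_mul]; norm_cast
  have a1 : s ^ (k ^ 2 - n ^ 2 - (k - m) ^ 2) =
      s ^ (k ^ 2 - n ^ 2 - (k - (m + 1 : ℕ) - 1) ^ 2) * (s ^ (-4 * k) * s ^ (4 * ((m : ℤ) + 1))) := by
    rw [← zpow_add₀ hs, ← zpow_add₀ hs]; congr 1; push_cast; ring
  have a2 : (k - (m + 1 : ℕ) - 1 : ℤ) = k - (m + 2 : ℕ) := by push_cast; ring
  rw [a1, hm, a2]
  ring

/-- Moments. -/
def mom {K : Type*} [Field K] (s : K) (a : ℕ → ℕ → K) (n m : ℕ) : K :=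
  ∑ r ∈ Finset.range (n + 1), a n r * wt s n ((n : ℤ) - 2 * r) m

theorem mom_step {K : Type*} [Field K] (s : K) (hs : s ≠ 0) (a : ℕ → ℕ → K)
    (h1 : ∀ n, a n 0 = 1) (hz : ∀ n r, n < r → a n r = 0)
    (hrec : ∀ n r, a (n + 1) (r + 1) = (s ^ 4) ^ (r + 1) * a n (r + 1) +
      ((s ^ 4) ^ (n - r) - (s ^ 4) ^ r) * a n r) (n m : ℕ) :
    mom s a (n + 1) m = ∑ r ∈ Finset.range (n + 1), a n r *
      (s ^ (4 * (r : ℤ)) * wt s (n + 1) ((n : ℤ) - 2 * r + 1) m +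
      (s ^ (4 * ((n : ℤ) - r)) - s ^ (4 * (r : ℤ))) * wt s (n + 1) ((n : ℤ) - 2 * r - 1) m) := by
  have hp : ∀ r : ℕ, (s ^ 4) ^ r = s ^ (4 * (r : ℤ)) := by
    intro r; rw [zpow_mul]; norm_cast
  have key : ∑ r ∈ Finset.range (n + 1), a n r * (s ^ (4 * (r : ℤ)) *
      wt s (n + 1) ((n : ℤ) - 2 * r + 1) m) = wt s (n + 1) (n + 1) m +
      ∑ r ∈ Finset.range (n + 1), (s ^ 4) ^ (r + 1) * a n (r + 1) *
        wt s (n + 1) ((n : ℤ) - 2 * r - 1) m := by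
    rw [Finset.sum_range_succ', Finset.sum_range_succ _ n, hz n (n + 1) (by omega)]
    simp only [h1]
    have : ∀ x y z : K, x = y → x + z = z + (y + 0) := by intros; subst_vars; ring
    simp only [mul_zero, zero_mul, Nat.cast_zero, zpow_zero, one_mul, sub_zero]
    apply this
    apply Finset.sum_congr rfl
    intro r _
    rw [hp, show ((n : ℤ) - 2 * ((r + 1 : ℕ) : ℤ) + 1) = (n : ℤ) - 2 * r - 1 by push_cast; ring]
    ring
  simp only [mul_add, Finset.sum_add_distrib]
  rw [key]
  unfold mom
  rw [Finset.sum_range_succ', h1, add_comm, add_assoc, ← Finset.sum_add_distrib]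
  congr 1
  · simp
  · apply Finset.sum_congr rfl
    intro r hr
    have hr' : r ≤ n := by simp at hr; omega
    rw [hrec, hp (n - r), hp r]
    rw [show (((n + 1 : ℕ) : ℤ) - 2 * ((r + 1 : ℕ) : ℤ)) = (n : ℤ) - 2 * r - 1 by push_cast; ring,
      Nat.cast_sub hr', show ((n + 1 : ℕ) : ℤ) = (n : ℤ) + 1 by push_cast; ring]
    ring

/-- Theta-type coefficients. -/
def phi {K : Type*} [Field K] (s : K) (l : ℤ) : K :=
  if l % 6 = 1 ∨ l % 6 = 2 then s ^ (-((l ^ 2 - 1) / 3)) else 0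

theorem phi_shift {K : Type*} [Field K] (s : K) (hs : s ≠ 0) (l : ℤ) :
    phi s (l + 3) = s ^ (-(2 * l + 3)) * phi s (-l) := by
  unfold phi
  by_cases h : (-l) % 6 = 1 ∨ (-l) % 6 = 2
  · rw [if_pos h, if_pos (by omega), ← zpow_add₀ hs]
    congr 1
    have : (l + 3) ^ 2 - 1 = ((-l) ^ 2 - 1) + (2 * l + 3) * 3 := by ring
    rw [this, Int.add_mul_ediv_right _ _ (by norm_num)]
    ring
  · rw [if_neg h, if_neg (by omega), mul_zero]

theorem psi_shift {K : Type*} [Field K] (s : K) (hs : s ≠ 0) (l : ℤ) :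
    phi s (l + 3) - phi s (-(l + 3)) = - s ^ (-(2 * l + 3)) * (phi s l - phi s (-l)) := by
  have h3 : phi s (-(l + 3)) = s ^ (-(2 * l + 3)) * phi s l := by
    unfold phi
    by_cases h : l % 6 = 1 ∨ l % 6 = 2
    · rw [if_pos h, if_pos (by omega), ← zpow_add₀ hs]
      congr 1
      have : (-(l + 3)) ^ 2 - 1 = (l ^ 2 - 1) + (2 * l + 3) * 3 := by ring
      rw [this, Int.add_mul_ediv_right _ _ (by norm_num)]
      ring
    · rw [if_neg h, if_neg (by omega), mul_zero]
  rw [h3, phi_shift s hs l]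
  ring

theorem base {K : Type*} [Field K] (s : K) (hs : s ≠ 0) (m : ℕ) :
    wt s 0 0 m = phi s ((m : ℤ) + 1) - phi s (-((m : ℤ) + 1)) := by
  have hstep : ∀ m : ℕ, wt s 0 0 (m + 3) = - s ^ (-(2 * ((m : ℤ) + 1) + 3)) * wt s 0 0 m := by
    intro m
    have h := qFib_rec3 (s ^ 4) (pow_ne_zero 4 hs) m 1
    have hm : (s ^ 4) ^ (m + 1) = s ^ (4 * ((m : ℤ) + 1)) := by
      rw [zpow_mul]; norm_cast
    unfold wt
    simp only [mul_zero, zpow_zero]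
    rw [h, hm]
    have a1 : s ^ ((0 : ℤ) ^ 2 - 0 ^ 2 - (0 - ((m + 3 : ℕ) : ℤ)) ^ 2) * s ^ (4 * ((m : ℤ) + 1)) =
        s ^ (-(2 * ((m : ℤ) + 1) + 3)) * s ^ ((0 : ℤ) ^ 2 - 0 ^ 2 - (0 - (m : ℤ)) ^ 2) := by
      rw [← zpow_add₀ hs, ← zpow_add₀ hs]; congr 1; push_cast; ring
    linear_combination (-qFib (s ^ 4) m 1) * a1
  have h012 : ∀ m : ℕ, (wt s 0 0 m = phi s ((m : ℤ) + 1) - phi s (-((m : ℤ) + 1))) ∧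
      (wt s 0 0 (m + 1) = phi s (((m + 1 : ℕ) : ℤ) + 1) - phi s (-(((m + 1 : ℕ) : ℤ) + 1))) ∧
      (wt s 0 0 (m + 2) = phi s (((m + 2 : ℕ) : ℤ) + 1) - phi s (-(((m + 2 : ℕ) : ℤ) + 1))) := by
    intro m
    induction m with
    | zero => refine ⟨?_, ?_, ?_⟩ <;> norm_num [wt, qFib, phi]
    | succ m ih =>
      refine ⟨ih.2.1, ih.2.2, ?_⟩
      rw [show m + 1 + 2 = m + 3 from rfl, hstep, ih.1, ← psi_shift s hs]
      push_cast
      ring_nf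
  exact (h012 m).1

/-- The solution of the ballot recurrence. -/
def bal {K : Type*} [Field K] (s : K) (n : ℕ) (m : ℤ) : K :=
  ∑ i ∈ Finset.range (n + 1), (n.choose i : K) *
    (phi s ((n : ℤ) - 2 * i + m) - phi s ((n : ℤ) - 2 * i - m))

theorem choose_sum {K : Type*} [Field K] (n : ℕ) (f : ℤ → K) :
    ∑ i ∈ Finset.range (n + 2), ((n + 1).choose i : K) * f ((n : ℤ) + 1 - 2 * i) =
    ∑ i ∈ Finset.range (n + 1), (n.choose i : K) *
      (f ((n : ℤ) - 2 * i + 1) + f ((n : ℤ) - 2 * i - 1)) := by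
  have key : ∑ i ∈ Finset.range (n + 1), (n.choose i : K) * f ((n : ℤ) - 2 * i + 1) =
      f ((n : ℤ) + 1) + ∑ i ∈ Finset.range (n + 1), (n.choose (i + 1) : K) *
        f ((n : ℤ) - 2 * i - 1) := by
    rw [Finset.sum_range_succ', Finset.sum_range_succ _ n, Nat.choose_succ_self]
    have : ∀ x y z : K, x = y → x + z = z + (y + 0) := by intros; subst_vars; ring
    simp only [Nat.choose_zero_right, Nat.cast_zero, Nat.cast_one, mul_zero, zero_mul, one_mul,
      sub_zero]
    apply this
    apply Finset.sum_congr rfl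
    intro i _
    rw [show ((n : ℤ) - 2 * ((i + 1 : ℕ) : ℤ) + 1) = (n : ℤ) - 2 * i - 1 by push_cast; ring]
  simp only [mul_add, Finset.sum_add_distrib]
  rw [key, Finset.sum_range_succ', add_comm, add_assoc, ← Finset.sum_add_distrib]
  congr 1
  · simp
  · apply Finset.sum_congr rfl
    intro i _
    rw [Nat.choose_succ_succ, show ((n : ℤ) + 1 - 2 * ((i + 1 : ℕ) : ℤ)) = (n : ℤ) - 2 * i - 1 by
      push_cast; ring]
    push_cast
    ring

theorem bal_step {K : Type*} [Field K] (s : K) (n : ℕ) (m : ℤ) :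
    bal s (n + 1) m = bal s n (m + 1) + bal s n (m - 1) := by
  have h := choose_sum n (fun l => phi s (l + m) - phi s (l - m))
  unfold bal
  push_cast
  rw [h, ← Finset.sum_add_distrib]
  apply Finset.sum_congr rfl
  intro i _
  rw [show (n : ℤ) - 2 * i + 1 + m = (n : ℤ) - 2 * i + (m + 1) by ring,
    show (n : ℤ) - 2 * i + 1 - m = (n : ℤ) - 2 * i - (m - 1) by ring,
    show (n : ℤ) - 2 * i - 1 + m = (n : ℤ) - 2 * i + (m - 1) by ring,
    show (n : ℤ) - 2 * i - 1 - m = (n : ℤ) - 2 * i - (m + 1) by ring]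
  ring

theorem mom_eq_bal {K : Type*} [Field K] (s : K) (hs : s ≠ 0) (a : ℕ → ℕ → K)
    (h1 : ∀ n, a n 0 = 1) (hz : ∀ n r, n < r → a n r = 0)
    (hrec : ∀ n r, a (n + 1) (r + 1) = (s ^ 4) ^ (r + 1) * a n (r + 1) +
      ((s ^ 4) ^ (n - r) - (s ^ 4) ^ r) * a n r) (n : ℕ) :
    ∀ m : ℕ, mom s a n m = bal s n ((m : ℤ) + 1) := by
  induction n with
  | zero =>
    intro m
    have := base s hs m
    simp [mom, bal, h1, this]
  | succ n ih =>
    intro m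
    rw [mom_step s hs a h1 hz hrec, bal_step]
    cases m with
    | zero =>
      have h0 : bal s n (((0 : ℕ) : ℤ) + 1 - 1) = 0 := by simp [bal]
      have h2 := ih 1
      rw [h0, add_zero, show (((0 : ℕ) : ℤ) + 1 + 1) = ((1 : ℕ) : ℤ) + 1 by norm_num, ← h2]
      unfold mom
      apply Finset.sum_congr rfl
      intro r _
      rw [wt_step_zero s hs n _ r rfl]
    | succ m =>
      have h2 := ih (m + 2)
      have h0 := ih m
      rw [show (((m + 1 : ℕ) : ℤ) + 1 + 1) = ((m + 2 : ℕ) : ℤ) + 1 by push_cast; ring,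
        show (((m + 1 : ℕ) : ℤ) + 1 - 1) = ((m : ℕ) : ℤ) + 1 by push_cast; ring, ← h2, ← h0]
      unfold mom
      rw [← Finset.sum_add_distrib]
      apply Finset.sum_congr rfl
      intro r _
      rw [wt_step_succ s hs n _ r rfl]
      ring

theorem intChoose_sum {K : Type*} [Field K] (N : ℕ) (k : ℤ) (x : K) :
    ∑ i ∈ Finset.range (N + 1), (if (i : ℤ) = k then (N.choose i : K) * x else 0) =
      (intChoose N k : K) * x := by
  unfold intChoose
  by_cases hk : 0 ≤ k
  · obtain ⟨t, rfl⟩ := Int.eq_ofNat_of_zero_le hk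
    simp only [Nat.cast_inj, Int.toNat_natCast, if_pos hk]
    rw [Finset.sum_ite_eq']
    split_ifs with h
    · simp
    · have : N < t := by simpa using h
      simp [Nat.choose_eq_zero_of_lt this]
  · rw [if_neg hk]
    simp only [Int.cast_zero, zero_mul]
    apply Finset.sum_eq_zero
    intro i _
    rw [if_neg (by omega)]

theorem phi_sum {K : Type*} [Field K] (s : K) (J : Finset ℤ) (c i : ℤ) (x : K)
    (hJ : ∀ j, i = c - 3 * j → j ∈ J) :
    ∑ j ∈ J, (if i = c - 3 * j then x * s ^ (-(12 * j ^ 2 + 8 * j + 1)) else 0) =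
      x * phi s (2 * (c - i) + 2) := by
  unfold phi
  split_ifs with h
  · obtain ⟨j, hj⟩ : ∃ j, i = c - 3 * j := ⟨(c - i) / 3, by omega⟩
    rw [Finset.sum_eq_single_of_mem j (hJ j hj)]
    · rw [if_pos hj]
      congr 3
      have : (2 * (c - i) + 2) ^ 2 - 1 = (12 * j ^ 2 + 8 * j + 1) * 3 := by rw [hj]; ring
      rw [this, Int.mul_ediv_cancel _ (by norm_num)]
    · intro b _ hb
      rw [if_neg (by omega)]
  · rw [mul_zero]
    apply Finset.sum_eq_zero
    intro j _
    rw [if_neg (by omega)]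

theorem bal_one {K : Type*} [Field K] (s : K) (n : ℕ) (J : Finset ℤ)
    (hJ : ∀ j : ℤ, -(n + 2 : ℤ) ≤ 3 * j → 3 * j ≤ n → j ∈ J) :
    bal s (2 * n + 1) 1 = ∑ j ∈ J, ((intChoose (2 * n + 1) ((n : ℤ) - 3 * j) -
              intChoose (2 * n + 1) ((n : ℤ) - 3 * j - 1) : ℤ) : K) *
          s ^ (-(12 * j ^ 2 + 8 * j + 1)) := by
  have aux : ∀ c : ℤ, (c = n ∨ c = n - 1) →
      ∑ i ∈ Finset.range (2 * n + 1 + 1), ((2 * n + 1).choose i : K) * phi s (2 * (c - i) + 2) =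
      ∑ j ∈ J, (intChoose (2 * n + 1) (c - 3 * j) : K) * s ^ (-(12 * j ^ 2 + 8 * j + 1)) := by
    intro c hc
    simp only [← intChoose_sum]
    rw [Finset.sum_comm]
    apply Finset.sum_congr rfl
    intro i hi
    have hi' : i ≤ 2 * n + 1 := by simpa using hi
    rw [phi_sum]
    intro j hj
    apply hJ <;> omega
  have e1 := aux n (Or.inl rfl)
  have e2 := aux (n - 1) (Or.inr rfl)
  unfold bal
  simp only [mul_sub, Finset.sum_sub_distrib, Int.cast_sub, sub_mul]
  simp only [show ∀ j : ℤ, (n : ℤ) - 3 * j - 1 = (n : ℤ) - 1 - 3 * j from fun j => by ring]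
  rw [← e1, ← e2]
  congr 1
  · apply Finset.sum_congr rfl
    intro i _
    congr 2
    push_cast
    ring
  · apply Finset.sum_congr rfl
    intro i _
    congr 2
    push_cast
    ring

theorem coef_zero (n : ℕ) (j : ℤ) (h : ¬ (-(n + 2 : ℤ) ≤ 3 * j ∧ 3 * j ≤ n)) :
    intChoose (2 * n + 1) ((n : ℤ) - 3 * j) - intChoose (2 * n + 1) ((n : ℤ) - 3 * j - 1) = 0 := by
  have aux : ∀ k : ℤ, (k < 0 ∨ 2 * (n : ℤ) + 1 < k) → intChoose (2 * n + 1) k = 0 := by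
    intro k hk
    unfold intChoose
    split_ifs with h
    · rw [Nat.choose_eq_zero_of_lt (by omega)]; rfl
    · rfl
  rw [aux _ (by omega), aux _ (by omega), sub_zero]

theorem A_zero {R : Type*} [CommRing R] (q : R) (a : ℕ → ℕ → R)
    (h0 : ∀ r, 1 ≤ r → a 0 r = 0)
    (hrec : ∀ n r, a (n + 1) (r + 1) = q ^ (r + 1) * a n (r + 1) +
      (q ^ (n - r) - q ^ r) * a n r) (n : ℕ) : ∀ r, n < 2 * r → a n r = 0 := by
  induction n with
  | zero => intro r hr; exact h0 r (by omega)
  | succ n ih =>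
    intro r hr
    obtain ⟨r, rfl⟩ : ∃ t, r = t + 1 := ⟨r - 1, by omega⟩
    rw [hrec, ih (r + 1) (by omega)]
    by_cases h : n < 2 * r
    · rw [ih r h]; ring
    · rw [show n - r = r by omega]; ring

theorem main_field {K : Type*} [Field K] (s : K) (hs : s ≠ 0) (a : ℕ → ℕ → K)
    (h1 : ∀ n, a n 0 = 1) (h0 : ∀ r, 1 ≤ r → a 0 r = 0)
    (hrec : ∀ n r, a (n + 1) (r + 1) = (s ^ 4) ^ (r + 1) * a n (r + 1) +
      ((s ^ 4) ^ (n - r) - (s ^ 4) ^ r) * a n r) (n : ℕ) (J : Finset ℤ)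
    (hJ : ∀ j : ℤ, -(n + 2 : ℤ) ≤ 3 * j → 3 * j ≤ n → j ∈ J) :
    ∑ r ∈ Finset.range (n + 1), a (2 * n + 1) r =
      ∑ j ∈ J, ((intChoose (2 * n + 1) ((n : ℤ) - 3 * j) -
              intChoose (2 * n + 1) ((n : ℤ) - 3 * j - 1) : ℤ) : K) *
          (s ^ 4) ^ ((n : ℤ) ^ 2 + n - 3 * j ^ 2 - 2 * j).toNat := by
  have hz := A_zero (s ^ 4) a h0 hrec
  have h := mom_eq_bal s hs a h1 (fun n r hr => hz n r (by omega)) hrec (2 * n + 1) 0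
  rw [show (((0 : ℕ) : ℤ) + 1) = 1 by norm_num, bal_one s n J hJ] at h
  have hm : mom s a (2 * n + 1) 0 = s ^ (-(2 * (n : ℤ) + 1) ^ 2) *
      ∑ r ∈ Finset.range (n + 1), a (2 * n + 1) r := by
    unfold mom
    rw [← Finset.sum_subset (s₁ := Finset.range (n + 1)), Finset.mul_sum]
    · apply Finset.sum_congr rfl
      intro r _
      simp only [wt, qFib]
      rw [mul_one, mul_comm]
      congr 2
      push_cast
      ring
    · intro x hx
      simp at hx ⊢
      omega
    · intro x _ hx
      have : n + 1 ≤ x := by simpa using hx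
      rw [hz _ _ (by omega), zero_mul]
  have hc : ∑ r ∈ Finset.range (n + 1), a (2 * n + 1) r =
      s ^ ((2 * (n : ℤ) + 1) ^ 2) * mom s a (2 * n + 1) 0 := by
    rw [hm, ← mul_assoc, ← zpow_add₀ hs, add_neg_cancel, zpow_zero, one_mul]
  rw [hc, h, Finset.mul_sum]
  apply Finset.sum_congr rfl
  intro j _
  by_cases hj : -(n + 2 : ℤ) ≤ 3 * j ∧ 3 * j ≤ n
  · have he : 0 ≤ (n : ℤ) ^ 2 + n - 3 * j ^ 2 - 2 * j := by
      nlinarith [mul_nonneg (sub_nonneg.2 hj.1) (sub_nonneg.2 hj.2), sq_nonneg (n : ℤ)]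
    have hp : (s ^ 4) ^ ((n : ℤ) ^ 2 + n - 3 * j ^ 2 - 2 * j).toNat =
        s ^ (4 * ((n : ℤ) ^ 2 + n - 3 * j ^ 2 - 2 * j)) := by
      rw [← zpow_natCast (s ^ 4), Int.toNat_of_nonneg he, zpow_mul]; norm_cast
    rw [hp, mul_left_comm, ← zpow_add₀ hs]
    congr 2
    ring
  · rw [coef_zero n j hj]; simp

theorem kirillov_A_sum_odd (A : ℕ → ℕ → Polynomial ℤ)
    (hA1 : ∀ n : ℕ, 1 ≤ n → A n 0 = 1)
    (hA0 : ∀ r : ℕ, 1 ≤ r → A 0 r = 0)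
    (hrec : ∀ n r : ℕ, A (n + 1) (r + 1) =
      (X : Polynomial ℤ) ^ (r + 1) * A n (r + 1) +
        ((X : Polynomial ℤ) ^ (n - r) - (X : Polynomial ℤ) ^ r) * A n r)
    (n : ℕ) :
    ∑ r ∈ Finset.range (n + 1), A (2 * n + 1) r =
      ∑ᶠ j : ℤ,
        Polynomial.C
            (intChoose (2 * n + 1) ((n : ℤ) - 3 * j) -
              intChoose (2 * n + 1) ((n : ℤ) - 3 * j - 1)) *
          (X : Polynomial ℤ) ^ ((n : ℤ) ^ 2 + n - 3 * j ^ 2 - 2 * j).toNat := by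
  have hJ : ∀ j : ℤ, -(n + 2 : ℤ) ≤ 3 * j → 3 * j ≤ n →
      j ∈ Finset.Icc (-(n + 2 : ℤ)) (n + 2 : ℤ) := by
    intro j h1 h2
    rw [Finset.mem_Icc]
    omega
  rw [finsum_eq_sum_of_support_subset (s := Finset.Icc (-(n + 2 : ℤ)) (n + 2 : ℤ))]
  swap
  · intro j hj
    by_contra hc
    apply hj
    have : ¬ (-(n + 2 : ℤ) ≤ 3 * j ∧ 3 * j ≤ n) := fun h => hc (by exact_mod_cast hJ j h.1 h.2)
    simp only [coef_zero n j this, map_zero, zero_mul]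
  apply Polynomial.map_injective (Int.castRingHom ℝ) Int.cast_injective
  apply Polynomial.eq_of_infinite_eval_eq
  apply (Set.Ioi_infinite (0 : ℝ)).mono
  intro x hx
  obtain ⟨s, hs, rfl⟩ : ∃ s : ℝ, s ≠ 0 ∧ s ^ 4 = x := by
    refine ⟨x ^ ((4 : ℕ)⁻¹ : ℝ), (Real.rpow_pos_of_pos hx _).ne', ?_⟩
    exact Real.rpow_inv_natCast_pow (le_of_lt hx) (by norm_num)
  have h := main_field s hs
    (fun n r => if n = 0 ∧ r = 0 then 1 else ((A n r).map (Int.castRingHom ℝ)).eval (s ^ 4))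
    (by
      intro n
      rcases Nat.eq_zero_or_pos n with h | h
      · simp [h]
      · simp [hA1 n h])
    (by
      intro r hr
      simp [hA0 r hr, Nat.one_le_iff_ne_zero.mp hr])
    (by
      intro n r
      by_cases h : n = 0 ∧ r = 0
      · obtain ⟨rfl, rfl⟩ := h
        simp [hrec]
      · simp only [if_neg h]
        simp [hrec])
    n _ hJ
  simp only [Set.mem_ofPred_eq]
  simp only [Polynomial.map_sum, Polynomial.eval_finsetSum]
  simp at h ⊢
  exact h
end
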